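/- arXiv:2107.04411 — 9 statements merged into one kernel-verified Lean document; each statement's English description precedes it below -/
import Mathlib

section
/- The formula (δ_g ⊗ h) ▷ (c ⊗ w) = [g = hch⁻¹] · (hch⁻¹ ⊗ π(ζ_c(h))w), for c ∈ C and w ∈ V_π, extends linearly to a left D(G)-module structure on ℂC ⊗ V_π; equivalently, the induced linear map D(G) → End(ℂC ⊗ V_π) is a unital algebra homomorphism. -/
/-!
The formula `(δ_g ⊗ h) ▷ (c ⊗ w) = [g = hch⁻¹] (hch⁻¹ ⊗ π(ζ_c(h)) w)` extends linearly
to a left `D(G)`-module structure on `ℂC ⊗ V_π`; equivalently, the induced linear map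
`D(G) → End(ℂC ⊗ V_π)` is a unital algebra homomorphism.
-/

noncomputable section

open scoped BigOperators Classical

/-- The quantum double `D(G)` as a vector space: the value at `(s, h)` is the
coefficient of the basis element `δ_s ⊗ h`. -/
abbrev DoubleDG (G : Type*) := G × G → ℂ

/-- The basis element `δ_s ⊗ h` of `D(G)`. -/
def DGbasis {G : Type*} [DecidableEq G] (s h : G) : DoubleDG G :=
  fun p => if p = (s, h) then 1 else 0

/-- The multiplication of `D(G)`, determined by
`(δ_s ⊗ h)(δ_t ⊗ g) = [s = hth⁻¹] (δ_s ⊗ hg)`. -/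
def DGmul {G : Type*} [Group G] [Fintype G] (x y : DoubleDG G) : DoubleDG G :=
  fun p => ∑ h : G, x (p.1, h) * y (h⁻¹ * p.1 * h, h⁻¹ * p.2)

/-- The unit `Σ_s δ_s ⊗ e` of `D(G)`. -/
def DGone {G : Type*} [Group G] [DecidableEq G] : DoubleDG G :=
  fun p => if p.2 = 1 then 1 else 0

/-- The antipode of `D(G)`: `S(δ_g ⊗ h) = δ_{h⁻¹g⁻¹h} ⊗ h⁻¹`. -/
def DGantipode {G : Type*} [Group G] (x : DoubleDG G) : DoubleDG G :=
  fun p => x (p.2⁻¹ * p.1⁻¹ * p.2, p.2⁻¹)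

variable {G : Type*} [Group G] [Fintype G] [DecidableEq G]

/-- The conjugacy class of `r`, as a subtype. -/
abbrev ConjCl (r : G) := {x : G // IsConj r x}

lemma isConj_conj_right {r c : G} (hc : IsConj r c) (h : G) :
    IsConj r (h⁻¹ * c * h) := by
  obtain ⟨g, hg⟩ := isConj_iff.1 hc
  refine isConj_iff.2 ⟨h⁻¹ * g, ?_⟩
  rw [← hg]; group

/-- The cocycle `ζ_c(g) = q_{g c g⁻¹}⁻¹ * g * q_c`. -/
def zeta {G : Type*} [Group G] (q : G → G) (c g : G) : G :=
  (q (g * c * g⁻¹))⁻¹ * g * q c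

variable {W : Type*} [AddCommGroup W] [Module ℂ W]

/-- The action of the basis element `δ_s ⊗ h` of `D(G)` on `V_{C,π} = ℂC ⊗ V_π`,
realised as `C → V_π`: on the basis vector `c ⊗ w` it is
`(δ_s ⊗ h) ▷ (c ⊗ w) = [s = hch⁻¹] (hch⁻¹ ⊗ π(ζ_c(h)) w)`. -/
def siteAct (r : G) (q : G → G) (π : G → Module.End ℂ W) (s h : G) :
    Module.End ℂ (ConjCl r → W) where
  toFun v := fun c =>
    if (c : G) = s then
      π (zeta q (h⁻¹ * c * h) h) (v ⟨h⁻¹ * c * h, isConj_conj_right c.2 h⟩)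
    else 0
  map_add' v w := by
    funext c
    by_cases hcs : (c : G) = s <;> simp [hcs]
  map_smul' a v := by
    funext c
    by_cases hcs : (c : G) = s <;> simp [hcs]

/-- The linear extension of the site action to all of `D(G)`. -/
def rep (r : G) (q : G → G) (π : G → Module.End ℂ W) (x : DoubleDG G) :
    Module.End ℂ (ConjCl r → W) :=
  ∑ s : G, ∑ h : G, x (s, h) • siteAct r q π s h

lemma zeta_mul {G : Type*} [Group G] (q : G → G) (c k l : G) :
    zeta q ((k * l)⁻¹ * c * (k * l)) (k * l) =
      zeta q (k⁻¹ * c * k) k * zeta q (l⁻¹ * (k⁻¹ * c * k) * l) l := by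
  have h₁ : k * l * ((k * l)⁻¹ * c * (k * l)) * (k * l)⁻¹ = c := by group
  have h₂ : k * (k⁻¹ * c * k) * k⁻¹ = c := by group
  have h₃ : l * (l⁻¹ * (k⁻¹ * c * k) * l) * l⁻¹ = k⁻¹ * c * k := by group
  have h₄ : (k * l)⁻¹ * c * (k * l) = l⁻¹ * (k⁻¹ * c * k) * l := by group
  unfold zeta
  rw [h₁, h₂, h₃, h₄]
  group

lemma zeta_commute {r : G} {q : G → G} (hq : ∀ c, IsConj r c → q c * r * (q c)⁻¹ = c)
    {c : G} (hc : IsConj r c) (h : G) :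
    zeta q (h⁻¹ * c * h) h * r = r * zeta q (h⁻¹ * c * h) h := by
  have e₁ : q c * r = c * q c := mul_inv_eq_iff_eq_mul.1 (hq c hc)
  have e₂ : q (h⁻¹ * c * h) * r = h⁻¹ * c * h * q (h⁻¹ * c * h) :=
    mul_inv_eq_iff_eq_mul.1 (hq _ (isConj_conj_right hc h))
  have e₃ : h * (h⁻¹ * c * h) * h⁻¹ = c := by group
  have e₄ : r = (q c)⁻¹ * c * q c := by rw [mul_assoc, ← e₁]; group
  unfold zeta
  rw [e₃, mul_assoc _ _ r, e₂]
  conv_rhs => rw [e₄]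
  group

lemma zeta_one {G : Type*} [Group G] (q : G → G) (c : G) : zeta q c 1 = 1 := by
  simp [zeta]

lemma rep_apply (r : G) (q : G → G) (π : G → Module.End ℂ W) (x : DoubleDG G)
    (v : ConjCl r → W) (c : ConjCl r) :
    rep r q π x v c = ∑ h : G, x (c, h) •
      π (zeta q (h⁻¹ * c * h) h) (v ⟨h⁻¹ * c * h, isConj_conj_right c.2 h⟩) := by
  simp only [rep, siteAct, LinearMap.sum_apply, LinearMap.smul_apply, LinearMap.coe_mk,
    AddHom.coe_mk, Finset.sum_apply, Pi.smul_apply, smul_ite, smul_zero]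
  rw [Finset.sum_comm]
  simp

theorem statement3 (r : G) (q : G → G)
    (hq : ∀ c, IsConj r c → q c * r * (q c)⁻¹ = c)
    [FiniteDimensional ℂ W]
    (π : G → Module.End ℂ W)
    (hπ1 : π 1 = 1)
    (hπmul : ∀ m n : G, m * r = r * m → n * r = r * n → π (m * n) = π m * π n) :
    (∀ x y : DoubleDG G,
        rep (W := W) r q π (DGmul x y) = rep r q π x * rep r q π y) ∧
    rep (W := W) r q π DGone = 1 := by
  constructor
  · intro x y
    refine LinearMap.ext fun v => funext fun c => ?_
    simp only [Module.End.mul_apply, rep_apply, DGmul, Finset.sum_smul, map_sum, map_smul,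
      Finset.smul_sum, smul_smul]
    rw [Finset.sum_comm]
    refine Finset.sum_congr rfl fun k _ => ?_
    rw [← Equiv.sum_comp (Equiv.mulLeft k)]
    refine Finset.sum_congr rfl fun l _ => ?_
    have hkl : (k * l)⁻¹ * (c : G) * (k * l) = l⁻¹ * (k⁻¹ * c * k) * l := by group
    simp only [Equiv.coe_mulLeft, inv_mul_cancel_left, zeta_mul]
    rw [hπmul _ _ (zeta_commute hq c.2 k)
      (zeta_commute hq (isConj_conj_right c.2 k) l), Module.End.mul_apply]
    simp only [hkl]
  · refine LinearMap.ext fun v => funext fun c => ?_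
    simp [rep_apply, DGone, zeta_one, hπ1]

end
end

section
/- Each P_{C,π} is central in D(G); they are orthogonal idempotents, P_{C,π} P_{C',π'} = 0 whenever C ≠ C' or π ≇ π' and P_{C,π}² = P_{C,π}; and they are complete: Σ_C Σ_{π ∈ Irr(C)} P_{C,π} = 1 in D(G). -/
/-!
The projectors `P_{C,π} ∈ D(G)` (one for each conjugacy class `C` of `G` and each
irreducible representation `π` of the centralizer of the chosen base point of `C`)
are central and form a complete orthogonal set of idempotents.
-/

noncomputable section

open scoped BigOperators Classical

set_option linter.unusedSectionVars false

variable {G : Type} [Group G] [Fintype G] [DecidableEq G]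

/-- The projector
`P_{C,π} = (dim V_π/|C_G|) Σ_{c∈C} Σ_{n∈C_G} Tr_π(n⁻¹) δ_c ⊗ q_c n q_c⁻¹ ∈ D(G)`. -/
def Pproj (r : G) (q : G → G) {W : Type} [AddCommGroup W] [Module ℂ W]
    (π : G → Module.End ℂ W) [FiniteDimensional ℂ W] : DoubleDG G :=
  ((Module.finrank ℂ W : ℂ) / ((Finset.univ.filter fun n : G => n * r = r * n).card : ℂ)) •
    ∑ c : G, ∑ n : G,
      if IsConj r c ∧ n * r = r * n then
        (LinearMap.trace ℂ W (π n⁻¹)) • DGbasis c (q c * n * (q c)⁻¹)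
      else 0

namespace Representation

open Module

section Isotypic

variable {H V W : Type*} [Group H] [Fintype H] [AddCommGroup V] [Module ℂ V]
  [AddCommGroup W] [Module ℂ W]

/-- The coefficient at `n` of the central idempotent `(dim V / |H|) ∑ χ(n⁻¹) n` of the group
algebra attached to the representation `ρ`. -/
def isotypicCoeff (ρ : Representation ℂ H V) (n : H) : ℂ :=
  (finrank ℂ V : ℂ) / (Nat.card H : ℂ) * ρ.character n⁻¹

theorem isotypicCoeff_conj (ρ : Representation ℂ H V) (m n : H) :
    ρ.isotypicCoeff (m * n * m⁻¹) = ρ.isotypicCoeff n := by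
  have h : (m * n * m⁻¹)⁻¹ = m * n⁻¹ * m⁻¹ := by group
  rw [isotypicCoeff, h, char_conj, isotypicCoeff]

theorem isotypicCoeff_of_subsingleton [Subsingleton V] (ρ : Representation ℂ H V) (n : H) :
    ρ.isotypicCoeff n = 0 := by
  simp [isotypicCoeff, finrank_zero_of_subsingleton]

theorem sum_isotypicCoeff_smul [FiniteDimensional ℂ V] [FiniteDimensional ℂ W]
    (ρ : Representation ℂ H V) (σ : Representation ℂ H W) [IsIrreducible ρ] [IsIrreducible σ] :
    ∑ n, ρ.isotypicCoeff n • σ n = if Nonempty (Equiv ρ σ) then 1 else 0 := by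
  set T : W →ₗ[ℂ] W := ∑ n, ρ.isotypicCoeff n • σ n with hT
  have hcomm (g : H) : T * σ g = σ g * T := by
    rw [hT, Finset.sum_mul, Finset.mul_sum]
    refine Fintype.sum_equiv (MulAut.conj g⁻¹).toEquiv _ _ fun n => ?_
    have h := isotypicCoeff_conj ρ g⁻¹ n
    simp only [MulEquiv.toEquiv_eq_coe, EquivLike.coe_coe, MulAut.conj_apply, h,
      smul_mul_assoc, mul_smul_comm, ← map_mul]
    congr 2
    group
  obtain ⟨c, hc⟩ := (IsIrreducible.algebraMap_intertwiningMap_bijective_of_isAlgClosed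
    (ρ := σ)).2 (⟨T, fun g => by simpa only [Module.End.mul_eq_comp] using hcomm g⟩ :
      IntertwiningMap σ σ)
  have hc' : T = c • (1 : Module.End ℂ W) := by
    ext w
    simpa using congr($hc w).symm
  have hcard : (Nat.card H : ℂ) ≠ 0 := by exact_mod_cast Nat.card_pos.ne'
  let _ : Invertible (Nat.card H : ℂ) := invertibleOfNonzero hcard
  have htr : c * (finrank ℂ W : ℂ) =
      (finrank ℂ V : ℂ) * if Nonempty (Equiv ρ σ) then 1 else 0 := by
    have h := congrArg (LinearMap.trace ℂ W) hc'
    rw [map_smul, LinearMap.trace_one, smul_eq_mul] at h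
    rw [← h, ← char_orthonormal σ ρ, hT, map_sum, Finset.mul_sum, Finset.mul_sum]
    refine Finset.sum_congr rfl fun n _ => ?_
    rw [map_smul, smul_eq_mul, isotypicCoeff, character, character]
    ring
  have : Nontrivial W := by
    have : Nontrivial σ.asModule := IsSimpleModule.nontrivial (MonoidAlgebra ℂ H) _
    exact this
  have hW : (finrank ℂ W : ℂ) ≠ 0 := by exact_mod_cast finrank_pos.ne'
  rw [hc']
  split_ifs at htr ⊢ with hiso
  · obtain ⟨φ⟩ := hiso
    rw [φ.toLinearEquiv.finrank_eq, mul_one] at htr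
    rw [mul_right_cancel₀ hW (htr.trans (one_mul _).symm), one_smul]
  · rw [mul_zero] at htr
    rw [(mul_eq_zero.1 htr).resolve_right hW, zero_smul]

theorem isotypicCoeff_convolution [FiniteDimensional ℂ V] [FiniteDimensional ℂ W]
    (ρ : Representation ℂ H V) (σ : Representation ℂ H W) [IsIrreducible ρ] [IsIrreducible σ]
    (g : H) :
    ∑ n, ρ.isotypicCoeff n * σ.isotypicCoeff (n⁻¹ * g) =
      if Nonempty (Equiv ρ σ) then σ.isotypicCoeff g else 0 := by
  have h : ∑ n, ρ.isotypicCoeff n * σ.isotypicCoeff (n⁻¹ * g) =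
      (finrank ℂ W : ℂ) / (Nat.card H : ℂ) *
        LinearMap.trace ℂ W (σ g⁻¹ * ∑ n, ρ.isotypicCoeff n • σ n) := by
    rw [Finset.mul_sum, map_sum, Finset.mul_sum]
    refine Finset.sum_congr rfl fun n _ => ?_
    rw [mul_smul_comm, map_smul, ← map_mul, smul_eq_mul, isotypicCoeff, isotypicCoeff, character,
      character, mul_inv_rev, inv_inv]
    ring
  rw [h, sum_isotypicCoeff_smul]
  split_ifs
  · rw [mul_one]; rfl
  · simp

/-- A family of pairwise non-isomorphic representations, irreducible unless zero, which meets
every isomorphism class of irreducible representations, has isotypic idempotents summing to `1`. -/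
theorem sum_isotypicCoeff_of_complete {H : Type} [Group H] [Fintype H] {J : Type*} [Fintype J]
    {V : J → Type*}
    [∀ j, AddCommGroup (V j)] [∀ j, Module ℂ (V j)] [∀ j, FiniteDimensional ℂ (V j)]
    (ρ : ∀ j, Representation ℂ H (V j)) (hirr : ∀ j, Nontrivial (V j) → IsIrreducible (ρ j))
    (hne : ∀ i j, i ≠ j → IsEmpty (Equiv (ρ i) (ρ j)))
    (hcomplete : ∀ (U : Type) [AddCommGroup U] [Module ℂ U] [FiniteDimensional ℂ U]
      (σ : Representation ℂ H U), IsIrreducible σ → ∃ j, Nonempty (Equiv σ (ρ j))) (g : H) :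
    ∑ j, (ρ j).isotypicCoeff g = if g = 1 then 1 else 0 := by
  have hact (U : Type) [AddCommGroup U] [Module ℂ U] [FiniteDimensional ℂ U]
      (σ : Representation ℂ H U) [IsIrreducible σ] :
      ∑ n, (∑ j, (ρ j).isotypicCoeff n) • σ n = 1 := by
    obtain ⟨j, ⟨φ⟩⟩ := hcomplete U σ inferInstance
    simp_rw [Finset.sum_smul]
    rw [Finset.sum_comm]
    have hterm (i : J) : ∑ n, (ρ i).isotypicCoeff n • σ n = if i = j then 1 else 0 := by
      rcases subsingleton_or_nontrivial (V i) with hi | hi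
      · have hij : i ≠ j := by
          rintro rfl
          have : Nontrivial σ.asModule := IsSimpleModule.nontrivial (MonoidAlgebra ℂ H) _
          exact not_subsingleton σ.asModule (φ.toLinearEquiv.toEquiv.subsingleton)
        simp [isotypicCoeff_of_subsingleton, hij]
      · have := hirr i hi
        rw [sum_isotypicCoeff_smul]
        refine if_congr ⟨fun ⟨ψ⟩ => ?_, ?_⟩ rfl rfl
        · by_contra hij
          exact (hne i j hij).false (ψ.trans φ)
        · rintro rfl
          exact ⟨φ.symm⟩
    simp [hterm]
  have hcard : NeZero (Nat.card H : ℂ) := ⟨by exact_mod_cast Nat.card_pos.ne'⟩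
  set E : MonoidAlgebra ℂ H := ∑ n, MonoidAlgebra.single n (∑ j, (ρ j).isotypicCoeff n) with hE
  have hEsmul (N : Submodule (MonoidAlgebra ℂ H) (MonoidAlgebra ℂ H))
      (hN : IsSimpleModule (MonoidAlgebra ℂ H) N) (x : N) : E • x = x := by
    have : Module.Finite ℂ N := Module.Finite.trans (MonoidAlgebra ℂ H) N
    let σ : Representation ℂ H N := ofModule' N
    have hσ (a : MonoidAlgebra ℂ H) (y : N) : σ.asAlgebraHom a y = a • y := by
      simp [σ, asAlgebraHom, ofModule']
    have hσ' (n : H) (y : N) : σ n y = MonoidAlgebra.single n (1 : ℂ) • y := by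
      rw [← hσ, asAlgebraHom_single_one]
    have : IsIrreducible σ := by
      refine { exists_pair_ne := ⟨⊥, ⊤, fun h => ?_⟩, eq_bot_or_eq_top := fun U => ?_ }
      · have := IsSimpleModule.nontrivial (MonoidAlgebra ℂ H) N
        exact bot_ne_top (α := Submodule ℂ N) (congrArg Subrepresentation.toSubmodule h)
      · let U' : Submodule (MonoidAlgebra ℂ H) N :=
          { U.toSubmodule with
            smul_mem' := fun a y hy => by
              induction a using MonoidAlgebra.induction_linear with
              | zero => rw [zero_smul]; exact U.toSubmodule.zero_mem
              | add a b ha hb => rw [add_smul]; exact U.toSubmodule.add_mem ha hb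
              | single n c =>
                rw [← hσ, asAlgebraHom_single]
                exact U.toSubmodule.smul_mem c (U.apply_mem_toSubmodule n hy) }
        refine (eq_bot_or_eq_top U').imp (fun h => ?_) fun h => ?_
        all_goals
          refine Subrepresentation.toSubmodule_injective (SetLike.coe_injective ?_)
          exact congrArg (fun P : Submodule (MonoidAlgebra ℂ H) N => (P : Set N)) h
    have h : σ.asAlgebraHom E = 1 := by
      rw [hE, map_sum]
      simpa only [asAlgebraHom_single] using hact N σ
    rw [← hσ, h, Module.End.one_apply]
  have hE1 : E = 1 := by
    have hfix (x : MonoidAlgebra ℂ H) (hx : x ∈ sSup {N : Submodule (MonoidAlgebra ℂ H)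
        (MonoidAlgebra ℂ H) | IsSimpleModule (MonoidAlgebra ℂ H) N}) : E * x = x := by
      rw [sSup_eq_iSup'] at hx
      induction hx using Submodule.iSup_induction' with
      | mem N x hx => exact congrArg Subtype.val (hEsmul N.1 N.2 ⟨x, hx⟩)
      | zero => exact mul_zero E
      | add x y _ _ hx hy => rw [mul_add, hx, hy]
    have h := hfix 1 (by rw [IsSemisimpleModule.sSup_simples_eq_top]; trivial)
    rwa [mul_one] at h
  have h := congrArg (fun x : MonoidAlgebra ℂ H => x.coeff g) hE1
  simpa [hE, MonoidAlgebra.one_def, Finsupp.single_apply, eq_comm] using h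

end Isotypic
end Representation

open Module

/-- `π` restricts to a representation of the centralizer of `r` which is irreducible or zero. -/
structure IsCentralizerIrrep (r : G) {W : Type} [AddCommGroup W] [Module ℂ W]
    (π : G → Module.End ℂ W) : Prop where
  map_one : π 1 = 1
  map_mul : ∀ m n : G, m * r = r * m → n * r = r * n → π (m * n) = π m * π n
  eq_bot_or_eq_top : ∀ U : Submodule ℂ W,
    (∀ n : G, n * r = r * n → ∀ w ∈ U, π n w ∈ U) → U = ⊥ ∨ U = ⊤

namespace IsCentralizerIrrep

variable {r : G} {W W' : Type} [AddCommGroup W] [Module ℂ W] [AddCommGroup W'] [Module ℂ W']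
  {π : G → Module.End ℂ W} {π' : G → Module.End ℂ W'}

/-- The representation of the centralizer of `r` underlying `π`. -/
def rep (h : IsCentralizerIrrep r π) : Representation ℂ (Subgroup.centralizer {r}) W where
  toFun n := π n
  map_one' := h.map_one
  map_mul' m n := h.map_mul m n (Subgroup.mem_centralizer_singleton_iff.1 m.2)
    (Subgroup.mem_centralizer_singleton_iff.1 n.2)

theorem isIrreducible_rep [Nontrivial W] (h : IsCentralizerIrrep r π) :
    h.rep.IsIrreducible where
  exists_pair_ne := ⟨⊥, ⊤, fun hbt => bot_ne_top (α := Submodule ℂ W)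
    (congrArg Subrepresentation.toSubmodule hbt)⟩
  eq_bot_or_eq_top U := by
    have hU := h.eq_bot_or_eq_top U.toSubmodule fun n hn w hw =>
      U.apply_mem_toSubmodule ⟨n, Subgroup.mem_centralizer_singleton_iff.2 hn⟩ hw
    exact hU.imp (fun e => Subrepresentation.toSubmodule_injective e)
      (fun e => Subrepresentation.toSubmodule_injective e)

theorem nonempty_equiv_iff (h : IsCentralizerIrrep r π) (h' : IsCentralizerIrrep r π') :
    Nonempty (Representation.Equiv h.rep h'.rep) ↔
      ∃ f : W ≃ₗ[ℂ] W', ∀ n : G, n * r = r * n → ∀ w, f (π n w) = π' n (f w) := by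
  constructor
  · rintro ⟨φ⟩
    exact ⟨φ.toLinearEquiv, fun n hn => Representation.IntertwiningMap.isIntertwining
      h.rep h'.rep φ.toIntertwiningMap ⟨n, Subgroup.mem_centralizer_singleton_iff.2 hn⟩⟩
  · rintro ⟨f, hf⟩
    exact ⟨Representation.Equiv.mk f fun n => LinearMap.ext fun w =>
      hf n (Subgroup.mem_centralizer_singleton_iff.1 n.2) w⟩

end IsCentralizerIrrep

/-- The coefficient of `n : G` in the central idempotent `P_π` of the group algebra of the
centralizer of `r`. -/
def projCoeff (r : G) {W : Type} [AddCommGroup W] [Module ℂ W] (π : G → Module.End ℂ W)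
    (n : G) : ℂ :=
  if n * r = r * n then
    (finrank ℂ W : ℂ) / (Nat.card (Subgroup.centralizer {r}) : ℂ) * LinearMap.trace ℂ W (π n⁻¹)
  else 0

section projCoeff

variable {r : G} {W W' : Type} [AddCommGroup W] [Module ℂ W] [AddCommGroup W'] [Module ℂ W']
  {π : G → Module.End ℂ W} {π' : G → Module.End ℂ W'}

theorem projCoeff_coe (h : IsCentralizerIrrep r π) (n : Subgroup.centralizer {r}) :
    projCoeff r π n = h.rep.isotypicCoeff n :=
  if_pos (Subgroup.mem_centralizer_singleton_iff.1 n.2)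

theorem projCoeff_of_not_commute {n : G} (hn : ¬ n * r = r * n) : projCoeff r π n = 0 :=
  if_neg hn

theorem projCoeff_conj (h : IsCentralizerIrrep r π) {m : G} (hm : m * r = r * m) (n : G) :
    projCoeff r π (m * n * m⁻¹) = projCoeff r π n := by
  rw [← Subgroup.mem_centralizer_singleton_iff] at hm
  by_cases hn : n * r = r * n
  · rw [← Subgroup.mem_centralizer_singleton_iff] at hn
    have := h.rep.isotypicCoeff_conj ⟨m, hm⟩ ⟨n, hn⟩
    rwa [← projCoeff_coe, ← projCoeff_coe] at this
  · rw [projCoeff_of_not_commute hn, projCoeff_of_not_commute]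
    rw [← Subgroup.mem_centralizer_singleton_iff] at hn ⊢
    rwa [Subgroup.mul_mem_cancel_right _ (inv_mem hm), Subgroup.mul_mem_cancel_left _ hm]

theorem projCoeff_convolution [FiniteDimensional ℂ W] [FiniteDimensional ℂ W']
    (h : IsCentralizerIrrep r π) (h' : IsCentralizerIrrep r π') (g : G) :
    ∑ n : G, projCoeff r π n * projCoeff r π' (n⁻¹ * g) =
      if ∃ f : W ≃ₗ[ℂ] W', ∀ n : G, n * r = r * n → ∀ w, f (π n w) = π' n (f w)
      then projCoeff r π' g else 0 := by
  have hsum : ∑ n : G, projCoeff r π n * projCoeff r π' (n⁻¹ * g) =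
      ∑ n : Subgroup.centralizer {r}, projCoeff r π n * projCoeff r π' ((n : G)⁻¹ * g) := by
    rw [← Finset.sum_subtype (Finset.univ.filter (· ∈ Subgroup.centralizer {r})) (by simp)
      fun n => projCoeff r π n * projCoeff r π' (n⁻¹ * g), Finset.sum_filter_of_ne]
    intro n _ hne
    by_contra hn
    rw [Subgroup.mem_centralizer_singleton_iff] at hn
    exact hne (by rw [projCoeff_of_not_commute hn, zero_mul])
  rw [hsum]
  by_cases hg : g * r = r * g
  · obtain ⟨g, rfl⟩ : ∃ k : Subgroup.centralizer {r}, (k : G) = g :=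
      ⟨⟨g, Subgroup.mem_centralizer_singleton_iff.2 hg⟩, rfl⟩
    have hconv : ∑ n : Subgroup.centralizer {r},
        projCoeff r π n * projCoeff r π' ((n : G)⁻¹ * g) =
        ∑ n, h.rep.isotypicCoeff n * h'.rep.isotypicCoeff (n⁻¹ * g) :=
      Finset.sum_congr rfl fun n _ => by rw [← projCoeff_coe, ← projCoeff_coe]; rfl
    rw [hconv]
    rcases subsingleton_or_nontrivial W with hW | hW
    · simp only [Representation.isotypicCoeff_of_subsingleton, zero_mul, Finset.sum_const_zero]
      split_ifs with hf
      · obtain ⟨f, -⟩ := hf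
        have := f.symm.toEquiv.subsingleton
        rw [projCoeff_coe h', Representation.isotypicCoeff_of_subsingleton]
      · rfl
    rcases subsingleton_or_nontrivial W' with hW' | hW'
    · simp [projCoeff_coe h', Representation.isotypicCoeff_of_subsingleton]
    have := h.isIrreducible_rep
    have := h'.isIrreducible_rep
    rw [Representation.isotypicCoeff_convolution, projCoeff_coe h']
    exact if_congr (h.nonempty_equiv_iff h') rfl rfl
  · rw [projCoeff_of_not_commute hg, ite_self]
    refine Finset.sum_eq_zero fun n _ => ?_
    rw [projCoeff_of_not_commute (n := (n : G)⁻¹ * g), mul_zero]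
    rw [← Subgroup.mem_centralizer_singleton_iff] at hg ⊢
    rwa [Subgroup.mul_mem_cancel_left _ (inv_mem n.2)]

end projCoeff

section Pproj

variable {r : G} {q : G → G} {W W' : Type} [AddCommGroup W] [Module ℂ W] [FiniteDimensional ℂ W]
  [AddCommGroup W'] [Module ℂ W'] [FiniteDimensional ℂ W']
  {π : G → Module.End ℂ W} {π' : G → Module.End ℂ W'}

theorem Pproj_apply (r : G) (q : G → G) (π : G → Module.End ℂ W) (s g : G) :
    Pproj r q π (s, g) = if IsConj r s then projCoeff r π ((q s)⁻¹ * g * q s) else 0 := by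
  have hcard : (Finset.univ.filter fun n : G => n * r = r * n).card =
      Nat.card (Subgroup.centralizer {r}) := by
    rw [Nat.card_eq_fintype_card, Fintype.card_subtype]
    simp only [Subgroup.mem_centralizer_singleton_iff]
  rw [Pproj, hcard, Pi.smul_apply, Finset.sum_apply, Finset.sum_eq_single s, Finset.sum_apply,
    Finset.sum_eq_single ((q s)⁻¹ * g * q s)]
  · have hg : q s * ((q s)⁻¹ * g * q s) * (q s)⁻¹ = g := by group
    by_cases h : IsConj r s ∧ (q s)⁻¹ * g * q s * r = r * ((q s)⁻¹ * g * q s)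
    · rw [if_pos h, if_pos h.1, projCoeff, if_pos h.2, hg, Pi.smul_apply, DGbasis, if_pos rfl]
      simp only [smul_eq_mul, mul_one]
    · rw [if_neg h, Pi.zero_apply, smul_zero]
      split_ifs with h1
      · exact (projCoeff_of_not_commute fun h2 => h ⟨h1, h2⟩).symm
      · rfl
  · intro n _ hn
    split_ifs
    · have : g ≠ q s * n * (q s)⁻¹ := by
        rintro rfl
        exact hn (by group)
      simp [DGbasis, this]
    · rfl
  · simp
  · intro c _ hc
    rw [Finset.sum_apply]
    refine Finset.sum_eq_zero fun n _ => ?_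
    split_ifs
    · simp [DGbasis, hc.symm]
    · rfl
  · simp

theorem conj_eq_of_Pproj_apply_ne_zero (hq : ∀ c, IsConj r c → q c * r * (q c)⁻¹ = c)
    {s h : G} (hne : Pproj r q π (s, h) ≠ 0) : h⁻¹ * s * h = s := by
  rw [Pproj_apply] at hne
  split_ifs at hne with hs
  · have hcomm : (q s)⁻¹ * h * q s * r = r * ((q s)⁻¹ * h * q s) := by
      by_contra hc
      exact hne (projCoeff_of_not_commute hc)
    have hs' := hq s hs
    have : s * h = h * s := by
      calc s * h = q s * r * (q s)⁻¹ * h := by rw [hs']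
        _ = q s * (r * ((q s)⁻¹ * h * q s)) * (q s)⁻¹ := by group
        _ = h * (q s * r * (q s)⁻¹) := by rw [← hcomm]; group
        _ = h * s := by rw [hs']
    rw [mul_assoc, this, inv_mul_cancel_left]
  · exact absurd rfl hne

theorem Pproj_conj (hq : ∀ c, IsConj r c → q c * r * (q c)⁻¹ = c)
    (hπ : IsCentralizerIrrep r π) (u s y : G) :
    Pproj r q π (u⁻¹ * s * u, u⁻¹ * y * u) = Pproj r q π (s, y) := by
  have hconj : IsConj s (u⁻¹ * s * u) := isConj_iff.2 ⟨u⁻¹, by group⟩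
  rw [Pproj_apply, Pproj_apply]
  by_cases hs : IsConj r s
  · have hs' : IsConj r (u⁻¹ * s * u) := hs.trans hconj
    rw [if_pos hs, if_pos hs']
    set t := u⁻¹ * s * u with ht
    have e1 := hq s hs
    have e2 := hq t hs'
    have hm : (q t)⁻¹ * u⁻¹ * q s * r = r * ((q t)⁻¹ * u⁻¹ * q s) := by
      calc (q t)⁻¹ * u⁻¹ * q s * r = (q t)⁻¹ * u⁻¹ * (q s * r * (q s)⁻¹) * q s := by group
        _ = (q t)⁻¹ * t * u⁻¹ * q s := by rw [e1]; simp only [ht, mul_assoc, mul_inv_cancel_left]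
        _ = (q t)⁻¹ * (q t * r * (q t)⁻¹) * u⁻¹ * q s := by rw [e2]
        _ = r * ((q t)⁻¹ * u⁻¹ * q s) := by group
    rw [← projCoeff_conj hπ hm ((q s)⁻¹ * y * q s)]
    congr 1
    group
  · rw [if_neg hs, if_neg fun h => hs (h.trans hconj.symm)]

theorem Pproj_central (hq : ∀ c, IsConj r c → q c * r * (q c)⁻¹ = c)
    (hπ : IsCentralizerIrrep r π) (x : DoubleDG G) :
    DGmul (Pproj r q π) x = DGmul x (Pproj r q π) := by
  funext ⟨s, g⟩
  simp only [DGmul]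
  refine Fintype.sum_equiv ((Equiv.inv G).trans (Equiv.mulRight g)) _ _ fun h => ?_
  simp only [Equiv.trans_apply, Equiv.inv_apply, Equiv.coe_mulRight]
  have key := Pproj_conj hq hπ (h⁻¹ * g) s h
  have e : (h⁻¹ * g)⁻¹ * h * (h⁻¹ * g) = (h⁻¹ * g)⁻¹ * g := by group
  rw [e] at key
  rw [key, mul_comm]
  by_cases h0 : Pproj r q π (s, h) = 0
  · rw [h0, mul_zero, mul_zero]
  · rw [conj_eq_of_Pproj_apply_ne_zero hq h0]

theorem Pproj_mul_Pproj (hq : ∀ c, IsConj r c → q c * r * (q c)⁻¹ = c)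
    (hπ : IsCentralizerIrrep r π) (hπ' : IsCentralizerIrrep r π') :
    DGmul (Pproj r q π) (Pproj r q π') =
      if ∃ f : W ≃ₗ[ℂ] W', ∀ n : G, n * r = r * n → ∀ w, f (π n w) = π' n (f w)
      then Pproj r q π' else 0 := by
  funext ⟨s, g⟩
  have hmul : DGmul (Pproj r q π) (Pproj r q π') (s, g) =
      if IsConj r s then
        ∑ n, projCoeff r π n * projCoeff r π' (n⁻¹ * ((q s)⁻¹ * g * q s)) else 0 := by
    have hstep (h : G) : Pproj r q π (s, h) * Pproj r q π' (h⁻¹ * s * h, h⁻¹ * g) =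
        Pproj r q π (s, h) * Pproj r q π' (s, h⁻¹ * g) := by
      by_cases h0 : Pproj r q π (s, h) = 0
      · rw [h0, zero_mul, zero_mul]
      · rw [conj_eq_of_Pproj_apply_ne_zero hq h0]
    simp only [DGmul, hstep]
    simp only [Pproj_apply]
    split_ifs
    · refine Fintype.sum_equiv (MulAut.conj (q s)⁻¹).toEquiv _ _ fun h => ?_
      simp only [MulEquiv.toEquiv_eq_coe, EquivLike.coe_coe, MulAut.conj_apply, inv_inv]
      congr 2
      group
    · simp
  rw [hmul, projCoeff_convolution hπ hπ']
  split_ifs <;> simp_all [Pproj_apply]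

theorem Pproj_mul_Pproj_of_not_isConj {r' : G} {q' : G → G}
    (hq : ∀ c, IsConj r c → q c * r * (q c)⁻¹ = c) (hr : ¬ IsConj r r') :
    DGmul (Pproj r q π) (Pproj r' q' π') = 0 := by
  funext ⟨s, g⟩
  refine Finset.sum_eq_zero fun h _ => ?_
  by_cases h0 : Pproj r q π (s, h) = 0
  · rw [h0, zero_mul]
  · simp only [conj_eq_of_Pproj_apply_ne_zero hq h0]
    rw [Pproj_apply] at h0
    rw [Pproj_apply r', if_neg, mul_zero]
    intro hs
    split_ifs at h0 with hs'
    · exact hr (hs'.trans hs.symm)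
    · exact h0 rfl

end Pproj

/-- Statement: indexing the pairs `(C, π)` of a conjugacy class together with (a
representative of an isomorphism class of) an irreducible representation of the
centralizer of its fixed base point by a finite type `ι`, the projectors `P_{C,π}`
are central in `D(G)`, pairwise orthogonal idempotents, and sum to `1`. -/
theorem statement4
    {ι : Type} [Fintype ι]
    (κ : ι → G)                                   -- the chosen base point `r_C`
    (q : ι → G → G)                               -- the section `q : C → G`
    (W : ι → Type) [∀ i, AddCommGroup (W i)] [∀ i, Module ℂ (W i)]
    [∀ i, FiniteDimensional ℂ (W i)]
    (π : ∀ i, G → Module.End ℂ (W i))             -- reps of the centralizers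
    (hq : ∀ i c, IsConj (κ i) c → q i c * κ i * (q i c)⁻¹ = c)
    (hπ1 : ∀ i, π i 1 = 1)
    (hπmul : ∀ i, ∀ m n : G, m * κ i = κ i * m → n * κ i = κ i * n →
      π i (m * n) = π i m * π i n)
    -- each `π i` is irreducible
    (hirr : ∀ i, ∀ U : Submodule ℂ (W i),
      (∀ n : G, n * κ i = κ i * n → ∀ w ∈ U, π i n w ∈ U) → U = ⊥ ∨ U = ⊤)
    -- pairs indexing the same conjugacy class use the same base point and section
    (hbase : ∀ i j, IsConj (κ i) (κ j) → κ i = κ j ∧ q i = q j)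
    -- distinct indices with the same conjugacy class carry non-isomorphic irreps
    (hdistinct : ∀ i j, i ≠ j → κ i = κ j →
      ¬ ∃ f : W i ≃ₗ[ℂ] W j, ∀ n : G, n * κ i = κ i * n →
        ∀ w : W i, f (π i n w) = π j n (f w))
    -- every conjugacy class of `G` occurs
    (hclass : ∀ g : G, ∃ i, IsConj (κ i) g)
    -- for each class, the family contains every irreducible representation of the
    -- centralizer of its base point up to isomorphism
    (hcomplete : ∀ i, ∀ (W' : Type) [AddCommGroup W'] [Module ℂ W']
      [FiniteDimensional ℂ W'], ∀ σ : G → Module.End ℂ W',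
      σ 1 = 1 →
      (∀ m n : G, m * κ i = κ i * m → n * κ i = κ i * n → σ (m * n) = σ m * σ n) →
      (∀ U : Submodule ℂ W',
        (∀ n : G, n * κ i = κ i * n → ∀ w ∈ U, σ n w ∈ U) → U = ⊥ ∨ U = ⊤) →
      ∃ j, κ j = κ i ∧ ∃ f : W' ≃ₗ[ℂ] W j, ∀ n : G, n * κ i = κ i * n →
        ∀ w : W', f (σ n w) = π j n (f w)) :
    (∀ i, ∀ x : DoubleDG G,
        DGmul (Pproj (κ i) (q i) (π i)) x = DGmul x (Pproj (κ i) (q i) (π i))) ∧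
    (∀ i j, i ≠ j → DGmul (Pproj (κ i) (q i) (π i)) (Pproj (κ j) (q j) (π j)) = 0) ∧
    (∀ i, DGmul (Pproj (κ i) (q i) (π i)) (Pproj (κ i) (q i) (π i)) =
        Pproj (κ i) (q i) (π i)) ∧
    (∑ i : ι, Pproj (κ i) (q i) (π i)) = DGone := by
  have hπ (i) : IsCentralizerIrrep (κ i) (π i) := ⟨hπ1 i, hπmul i, hirr i⟩
  refine ⟨fun i => Pproj_central (hq i) (hπ i), fun i j hij => ?_, fun i => ?_, ?_⟩
  · by_cases hc : IsConj (κ i) (κ j)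
    · obtain ⟨hκ, hqq⟩ := hbase i j hc
      have hj : IsCentralizerIrrep (κ i) (π j) := by rw [hκ]; exact hπ j
      rw [← hκ, ← hqq, Pproj_mul_Pproj (hq i) (hπ i) hj, if_neg (hdistinct i j hij hκ)]
    · exact Pproj_mul_Pproj_of_not_isConj (hq i) hc
  · rw [Pproj_mul_Pproj (hq i) (hπ i) (hπ i), if_pos ⟨.refl ℂ _, fun _ _ _ => rfl⟩]
  funext ⟨s, g⟩
  obtain ⟨i, hi⟩ := hclass s
  have hπi (j) (hj : κ j = κ i) : IsCentralizerIrrep (κ i) (π j) := by rw [← hj]; exact hπ j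
  have hπ' (j : {j // κ j = κ i}) := hπi j j.2
  have hsum : (∑ j, Pproj (κ j) (q j) (π j)) (s, g) =
      ∑ j : {j // κ j = κ i}, projCoeff (κ i) (π j) ((q i s)⁻¹ * g * q i s) := by
    rw [← Finset.sum_subtype (Finset.univ.filter fun j => κ j = κ i) (by simp)
      fun j => projCoeff (κ i) (π j) ((q i s)⁻¹ * g * q i s), Finset.sum_filter, Finset.sum_apply]
    refine Finset.sum_congr rfl fun j _ => ?_
    rw [Pproj_apply]
    by_cases hj : κ j = κ i
    · have hjs : IsConj (κ j) s := by rwa [hj]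
      rw [if_pos hjs, if_pos hj, hj, (hbase j i (hjs.trans hi.symm)).2]
    · rw [if_neg hj, if_neg fun hjs => hj (hbase j i (hjs.trans hi.symm)).1]
  rw [hsum, DGone]
  by_cases hn : (q i s)⁻¹ * g * q i s ∈ Subgroup.centralizer {κ i}
  · have h := Representation.sum_isotypicCoeff_of_complete (fun j => (hπ' j).rep)
      (fun j _ => (hπ' j).isIrreducible_rep)
      (fun j k hjk => not_nonempty_iff.1 fun hne => by
        obtain ⟨f, hf⟩ := ((hπ' j).nonempty_equiv_iff (hπ' k)).1 hne
        exact hdistinct j k (fun e => hjk (Subtype.ext e)) (j.2.trans k.2.symm)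
          ⟨f, fun n hn => hf n (by rwa [← j.2])⟩)
      (fun U _ _ _ σ hσ => by
        let τ : G → Module.End ℂ U :=
          fun n => if h : n ∈ Subgroup.centralizer {κ i} then σ ⟨n, h⟩ else 0
        have hτ (n : Subgroup.centralizer {κ i}) : τ n = σ n := dif_pos n.2
        have hτ' : IsCentralizerIrrep (κ i) τ := by
          refine ⟨(hτ 1).trans (map_one σ), fun m n hm hn => ?_, fun U' hU' => ?_⟩
          · rw [← Subgroup.mem_centralizer_singleton_iff] at hm hn
            have h := map_mul σ ⟨m, hm⟩ ⟨n, hn⟩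
            rwa [← hτ, ← hτ, ← hτ] at h
          · have h := hσ.eq_bot_or_eq_top ⟨U', fun n w hw => by
              rw [← hτ]
              exact hU' n (Subgroup.mem_centralizer_singleton_iff.1 n.2) w hw⟩
            exact h.imp (congrArg Subrepresentation.toSubmodule)
              (congrArg Subrepresentation.toSubmodule)
        have hrep : hτ'.rep = σ := MonoidHom.ext hτ
        obtain ⟨j, hj, hf⟩ :=
          hcomplete i U τ hτ'.map_one hτ'.map_mul hτ'.eq_bot_or_eq_top
        rw [← hrep]
        exact ⟨⟨j, hj⟩, (hτ'.nonempty_equiv_iff (hπi j hj)).2 hf⟩) ⟨_, hn⟩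
    simp only [← projCoeff_coe] at h
    rw [h]
    have h1 : (⟨_, hn⟩ : Subgroup.centralizer {κ i}) = 1 ↔ g = 1 := by
      rw [Subtype.ext_iff]
      simpa using conj_eq_one_iff (a := (q i s)⁻¹) (b := g)
    simp only [h1]
  · have hg : g ≠ 1 := by
      rintro rfl
      exact hn (by simp)
    rw [if_neg hg]
    exact Finset.sum_eq_zero fun j _ =>
      projCoeff_of_not_commute fun h => hn (Subgroup.mem_centralizer_singleton_iff.2 h)

end
end

section
/- For all h, g ∈ G one has (h ▷) ∘ (δ_g ▷) = (δ_{hgh⁻¹} ▷) ∘ (h ▷) as operators on V; consequently δ_g ⊗ h ↦ (δ_g ▷) ∘ (h ▷) extends linearly to a unital algebra homomorphism D(G) → End(V), i.e. a representation of the quantum double at the site (v, p). -/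
/-!
The Kitaev site representation of the quantum double `D(G)` on the space of states
on the six arrows at a site `(v, p)` of the oriented square lattice.
-/

noncomputable section

open scoped BigOperators

/-- The state space at the site `(v,p)`: basis vectors `|x_a,…,x_f⟩` record group
elements on the six arrows `a,…,f` around the site (indexed `0,…,5`). -/
abbrev SiteV (G : Type*) := (Fin 6 → G) → ℂ

variable {G : Type*} [Group G] [Fintype G] [DecidableEq G]

/-- The vertex action `h ▷ |x_a,…,x_f⟩ = |h x_a, x_b h⁻¹, x_c h⁻¹, h x_d, x_e, x_f⟩`. -/
def vertexAct (h : G) : Module.End ℂ (SiteV G) where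
  toFun v := fun y => v ![h⁻¹ * y 0, y 1 * h, y 2 * h, h⁻¹ * y 3, y 4, y 5]
  map_add' _ _ := rfl
  map_smul' _ _ := rfl

/-- The face action `δ_g ▷ |x_a,…,x_f⟩ = [x_a x_f x_e⁻¹ x_d⁻¹ = g] |x_a,…,x_f⟩`. -/
def faceAct (g : G) : Module.End ℂ (SiteV G) where
  toFun v := fun y => if y 0 * y 5 * (y 4)⁻¹ * (y 3)⁻¹ = g then v y else 0
  map_add' v w := by
    funext y
    by_cases h : y 0 * y 5 * (y 4)⁻¹ * (y 3)⁻¹ = g <;> simp [h]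
  map_smul' a v := by
    funext y
    by_cases h : y 0 * y 5 * (y 4)⁻¹ * (y 3)⁻¹ = g <;> simp [h]

/-- The linear extension of `δ_g ⊗ h ↦ (δ_g ▷) ∘ (h ▷)`. -/
def siteRep (x : DoubleDG G) : Module.End ℂ (SiteV G) :=
  ∑ g : G, ∑ h : G, x (g, h) • (faceAct g * vertexAct h)

omit [Fintype G] [DecidableEq G] in
theorem vertexAct_one : vertexAct (1 : G) = 1 := by
  refine LinearMap.ext fun v => ?_
  funext y
  simp only [vertexAct, LinearMap.coe_mk, AddHom.coe_mk, Module.End.one_apply]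
  congr 1
  funext i
  fin_cases i <;> simp

omit [Fintype G] [DecidableEq G] in
theorem vertexAct_mul (h k : G) : vertexAct h * vertexAct k = vertexAct (h * k) := by
  refine LinearMap.ext fun v => ?_
  funext y
  simp [vertexAct, mul_assoc]

omit [Fintype G] in
theorem faceAct_mul (g k : G) :
    faceAct g * faceAct k = if k = g then faceAct g else 0 := by
  refine LinearMap.ext fun v => ?_
  funext y
  split_ifs with hkg
  · subst hkg
    simp +contextual [faceAct]
  · simp only [faceAct, Module.End.mul_apply, LinearMap.coe_mk, AddHom.coe_mk,
      LinearMap.zero_apply, Pi.zero_apply]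
    split_ifs with h₁ h₂
    · exact absurd (h₂.symm.trans h₁) hkg
    all_goals rfl

theorem sum_faceAct : ∑ g : G, faceAct g = 1 := by
  refine LinearMap.ext fun v => ?_
  funext y
  simp [faceAct, LinearMap.sum_apply, Finset.sum_apply]

omit [Fintype G] in
theorem vertexAct_mul_faceAct (h g : G) :
    vertexAct h * faceAct g = faceAct (h * g * h⁻¹) * vertexAct h := by
  refine LinearMap.ext fun v => ?_
  funext y
  have hiff : h⁻¹ * y 0 * y 5 * (y 4)⁻¹ * (h⁻¹ * y 3)⁻¹ = g ↔
      y 0 * y 5 * (y 4)⁻¹ * (y 3)⁻¹ = h * g * h⁻¹ := by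
    rw [eq_mul_inv_iff_mul_eq, ← inv_mul_eq_iff_eq_mul]
    simp only [mul_inv_rev, inv_inv, mul_assoc]
  exact if_congr hiff rfl rfl

omit [Fintype G] in
theorem faceAct_vertexAct_mul (g k s m : G) :
    faceAct g * vertexAct k * (faceAct s * vertexAct m) =
      if s = k⁻¹ * g * k then faceAct g * vertexAct (k * m) else 0 := by
  have hiff : k * s * k⁻¹ = g ↔ s = k⁻¹ * g * k := by
    rw [mul_inv_eq_iff_eq_mul, mul_assoc, eq_inv_mul_iff_mul_eq]
  rw [mul_assoc, ← mul_assoc (vertexAct k), vertexAct_mul_faceAct, mul_assoc,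
    vertexAct_mul, ← mul_assoc, faceAct_mul, ite_mul, zero_mul]
  exact if_congr hiff rfl rfl

theorem siteRep_mul (x y : DoubleDG G) : siteRep (DGmul x y) = siteRep x * siteRep y := by
  simp only [siteRep, DGmul, Finset.sum_mul, Finset.sum_smul]
  refine Finset.sum_congr rfl fun g _ => ?_
  rw [Finset.sum_comm]
  refine Finset.sum_congr rfl fun k _ => ?_
  simp only [Finset.mul_sum, smul_mul_smul_comm, faceAct_vertexAct_mul, smul_ite, smul_zero]
  rw [Finset.sum_comm]
  simp only [Finset.sum_ite_eq', Finset.mem_univ, if_true]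
  exact Fintype.sum_equiv (Equiv.mulLeft k⁻¹) _ _ fun h => by simp

theorem siteRep_one : siteRep (G := G) DGone = 1 := by
  simp [siteRep, DGone, vertexAct_one, sum_faceAct]

/-- `(h ▷) ∘ (δ_g ▷) = (δ_{hgh⁻¹} ▷) ∘ (h ▷)`; consequently
`δ_g ⊗ h ↦ (δ_g ▷) ∘ (h ▷)` extends linearly to a unital algebra homomorphism
`D(G) → End(V)`, i.e. a representation of the quantum double at the site `(v,p)`. -/
theorem statement8 :
    (∀ h g : G, vertexAct h * faceAct g = faceAct (h * g * h⁻¹) * vertexAct h) ∧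
    (∀ x y : DoubleDG G, siteRep (DGmul x y) = siteRep x * siteRep y) ∧
    siteRep (G := G) DGone = 1 :=
  ⟨vertexAct_mul_faceAct, siteRep_mul, siteRep_one⟩

end
end

section
/- For all h, h', g, g' ∈ G: F^{h,g} ∘ F^{h',g'} = [g = g'] · F^{hh', g}, and the Hermitian adjoint with respect to the given orthonormal basis is (F^{h,g})† = F^{h⁻¹, g}. In particular (F^{h,g})† ∘ F^{h,g} = F^{h,g} ∘ (F^{h,g})† = F^{e,g} and Σ_{g ∈ G} F^{e,g} = id. -/
/-!
Composition and adjointness of the `D(G)` ribbon operators `F^{h,g}` acting on the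
eight arrows of the ribbon of Figure 1.
-/

noncomputable section

open scoped BigOperators ComplexConjugate

/-- The state space on the eight arrows affected by the ribbon: basis vectors
`|h¹,h²,h³,h⁴; g¹,g²,g³,g⁴⟩`. -/
abbrev RibV (G : Type*) := ((Fin 4 → G) × (Fin 4 → G)) → ℂ

variable {G : Type*} [Group G] [Fintype G] [DecidableEq G]

/-- The ribbon operator `F^{h,g}`, acting on basis vectors by
`F^{h,g}|h¹,…,h⁴; g¹,…,g⁴⟩ = [h¹h²(h³)⁻¹h⁴ = g] ·
 |h¹,…,h⁴; g¹h⁻¹, g²(h¹)⁻¹h⁻¹h¹, g³·m, g⁴·m⟩` with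
`m = h³(h²)⁻¹(h¹)⁻¹h⁻¹h¹h²(h³)⁻¹`. -/
def ribbonF (h g : G) : Module.End ℂ (RibV G) where
  toFun v := fun x =>
    if x.1 0 * x.1 1 * (x.1 2)⁻¹ * x.1 3 = g then
      v (x.1,
        ![x.2 0 * h,
          x.2 1 * ((x.1 0)⁻¹ * h * x.1 0),
          x.2 2 * (x.1 2 * (x.1 1)⁻¹ * (x.1 0)⁻¹ * h * x.1 0 * x.1 1 * (x.1 2)⁻¹),
          x.2 3 * (x.1 2 * (x.1 1)⁻¹ * (x.1 0)⁻¹ * h * x.1 0 * x.1 1 * (x.1 2)⁻¹)])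
    else 0
  map_add' v w := by
    funext x
    by_cases hx : x.1 0 * x.1 1 * (x.1 2)⁻¹ * x.1 3 = g <;> simp [hx]
  map_smul' a v := by
    funext x
    by_cases hx : x.1 0 * x.1 1 * (x.1 2)⁻¹ * x.1 3 = g <;> simp [hx]

/-- The inner product for which the basis vectors are orthonormal. -/
def ribIP (v w : RibV G) : ℂ := ∑ x : (Fin 4 → G) × (Fin 4 → G), conj (v x) * w x

/-- The translation of labels through which `ribbonF h g` pulls back vectors. -/
def ribbonShift (h : G) (x : (Fin 4 → G) × (Fin 4 → G)) : (Fin 4 → G) × (Fin 4 → G) :=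
  (x.1,
    ![x.2 0 * h,
      x.2 1 * ((x.1 0)⁻¹ * h * x.1 0),
      x.2 2 * (x.1 2 * (x.1 1)⁻¹ * (x.1 0)⁻¹ * h * x.1 0 * x.1 1 * (x.1 2)⁻¹),
      x.2 3 * (x.1 2 * (x.1 1)⁻¹ * (x.1 0)⁻¹ * h * x.1 0 * x.1 1 * (x.1 2)⁻¹)])

theorem ribbonF_apply {G : Type*} [Group G] [DecidableEq G] (h g : G) (v : RibV G)
    (x : (Fin 4 → G) × (Fin 4 → G)) :
    ribbonF h g v x =
      if x.1 0 * x.1 1 * (x.1 2)⁻¹ * x.1 3 = g then v (ribbonShift h x) else 0 :=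
  rfl

theorem ribbonShift_fst {G : Type*} [Group G] (h : G) (x : (Fin 4 → G) × (Fin 4 → G)) :
    (ribbonShift h x).1 = x.1 :=
  rfl

theorem ribbonShift_one {G : Type*} [Group G] (x : (Fin 4 → G) × (Fin 4 → G)) :
    ribbonShift 1 x = x := by
  refine Prod.ext rfl (funext fun i => ?_)
  fin_cases i <;> simp [ribbonShift]

theorem ribbonShift_ribbonShift {G : Type*} [Group G] (h h' : G)
    (x : (Fin 4 → G) × (Fin 4 → G)) :
    ribbonShift h' (ribbonShift h x) = ribbonShift (h * h') x := by
  refine Prod.ext rfl (funext fun i => ?_)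
  fin_cases i <;> simp [ribbonShift, mul_assoc]

/-- Translation of labels as a permutation. -/
def ribbonShiftEquiv (h : G) : Equiv.Perm ((Fin 4 → G) × (Fin 4 → G)) where
  toFun := ribbonShift h
  invFun := ribbonShift h⁻¹
  left_inv x := by rw [ribbonShift_ribbonShift, mul_inv_cancel, ribbonShift_one]
  right_inv x := by rw [ribbonShift_ribbonShift, inv_mul_cancel, ribbonShift_one]

theorem ribbonF_mul_ribbonF {G : Type*} [Group G] [DecidableEq G] (h h' g g' : G) :
    ribbonF h g * ribbonF h' g' =
      if g = g' then ribbonF (h * h') g else (0 : Module.End ℂ (RibV G)) := by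
  refine LinearMap.ext fun v => funext fun x => ?_
  rw [Module.End.mul_apply, ribbonF_apply, ribbonF_apply, ribbonShift_fst,
    ribbonShift_ribbonShift]
  by_cases hg : g = g'
  · subst hg
    rw [if_pos rfl, ribbonF_apply]
    split_ifs <;> rfl
  · rw [if_neg hg, LinearMap.zero_apply, Pi.zero_apply]
    split_ifs with hx hx'
    · exact absurd (hx.symm.trans hx') hg
    · rfl
    · rfl

theorem ribIP_ribbonF_inv_left (h g : G) (v w : RibV G) :
    ribIP (ribbonF h⁻¹ g v) w = ribIP v (ribbonF h g w) := by
  refine (Equiv.sum_comp (ribbonShiftEquiv h) _).symm.trans (Finset.sum_congr rfl fun x _ => ?_)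
  change conj (ribbonF h⁻¹ g v (ribbonShift h x)) * w (ribbonShift h x) = _
  rw [ribbonF_apply, ribbonF_apply, ribbonShift_fst, ribbonShift_ribbonShift, mul_inv_cancel,
    ribbonShift_one]
  split_ifs <;> simp

theorem sum_ribbonF_one : (∑ g : G, ribbonF (1 : G) g) = (1 : Module.End ℂ (RibV G)) := by
  refine LinearMap.ext fun v => funext fun x => ?_
  simp [LinearMap.sum_apply, Finset.sum_apply, ribbonF_apply, ribbonShift_one]

/-- `F^{h,g} ∘ F^{h',g'} = [g = g'] F^{hh',g}`; the Hermitian adjoint w.r.t. the given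
orthonormal basis is `(F^{h,g})† = F^{h⁻¹,g}`; in particular
`(F^{h,g})† ∘ F^{h,g} = F^{h,g} ∘ (F^{h,g})† = F^{e,g}` and `Σ_g F^{e,g} = id`. -/
theorem statement10 :
    (∀ h h' g g' : G,
        ribbonF h g * ribbonF h' g' = if g = g' then ribbonF (h * h') g else (0 : Module.End ℂ (RibV G))) ∧
    (∀ (h g : G) (v w : RibV G), ribIP (ribbonF h⁻¹ g v) w = ribIP v (ribbonF h g w)) ∧
    (∀ h g : G, ribbonF h⁻¹ g * ribbonF h g = ribbonF (1 : G) g) ∧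
    (∀ h g : G, ribbonF h g * ribbonF h⁻¹ g = ribbonF (1 : G) g) ∧
    (∑ g : G, ribbonF (1 : G) g) = (1 : Module.End ℂ (RibV G)) := by
  refine ⟨ribbonF_mul_ribbonF, ribIP_ribbonF_inv_left, fun h g => ?_, fun h g => ?_,
    sum_ribbonF_one⟩
  · rw [ribbonF_mul_ribbonF, if_pos rfl, inv_mul_cancel]
  · rw [ribbonF_mul_ribbonF, if_pos rfl, mul_inv_cancel]

end
end

section
/- Under these hypotheses, ⟨F^{h,g}Ω, F^{h',g'}Ω⟩ = [h = h'][g = g'] / |G| for all h, h', g, g' ∈ G; in particular the |G|² vectors F^{h,g}Ω are pairwise orthogonal and nonzero. -/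
/-!
Orthogonality of ribbon states: `⟨F^{h,g}Ω, F^{h',g'}Ω⟩ = [h = h'][g = g']/|G|`.
-/

noncomputable section

open scoped BigOperators InnerProductSpace

variable {G : Type*} [Group G] [Fintype G] [DecidableEq G]
variable {H : Type*} [NormedAddCommGroup H] [InnerProductSpace ℂ H] [FiniteDimensional ℂ H]

omit [FiniteDimensional ℂ H] in
/-- The vacuum is fixed by the vertex action of every group element. -/
lemma vertex_apply_vacuum (ρ : DoubleDG G →ₗ[ℂ] (H →ₗ[ℂ] H)) (Ω : H)
    (hΩ : ∀ f f' : G, ρ (DGbasis f f') Ω = (if f = 1 then (1 : ℂ) else 0) • Ω) (f : G) :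
    ρ (∑ t : G, DGbasis t f) Ω = Ω := by
  rw [map_sum, LinearMap.sum_apply]
  simp [hΩ]

omit [Fintype G] in
/-- The vacuum expectation of a ribbon operator with nontrivial flux vanishes. -/
lemma inner_vacuum_ribbon_eq_zero (ρ : DoubleDG G →ₗ[ℂ] (H →ₗ[ℂ] H))
    (hadj_face : ∀ f : G,
      LinearMap.adjoint (ρ (DGbasis f 1)) = ρ (DGbasis f 1))
    (F : G → G → (H →ₗ[ℂ] H))
    (hcomm_face : ∀ f h g : G,
      ρ (DGbasis f 1) * F h g = F h g * ρ (DGbasis (f * (g⁻¹ * h * g)) 1))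
    (Ω : H)
    (hΩ : ∀ f f' : G, ρ (DGbasis f f') Ω = (if f = 1 then (1 : ℂ) else 0) • Ω)
    {k : G} (hk : k ≠ 1) (g : G) : ⟪Ω, F k g Ω⟫_ℂ = 0 := by
  have hconj : g⁻¹ * k * g ≠ 1 := fun h => hk <| by
    simpa using (conj_eq_one_iff (a := g⁻¹) (b := k)).1 (by simpa using h)
  have hface : ρ (DGbasis 1 1) (F k g Ω) = 0 := by
    have := LinearMap.congr_fun (hcomm_face 1 k g) Ω
    simpa only [Module.End.mul_apply, hΩ, one_mul, if_neg hconj, zero_smul, map_zero] using this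
  calc ⟪Ω, F k g Ω⟫_ℂ = ⟪ρ (DGbasis 1 1) Ω, F k g Ω⟫_ℂ := by simp [hΩ]
    _ = ⟪Ω, ρ (DGbasis 1 1) (F k g Ω)⟫_ℂ := by
      rw [← LinearMap.adjoint_inner_right, hadj_face]
    _ = 0 := by rw [hface, inner_zero_right]

/-- The vacuum expectation of a ribbon operator with trivial flux is `1 / |G|`. -/
lemma inner_vacuum_ribbon_one (ρ : DoubleDG G →ₗ[ℂ] (H →ₗ[ℂ] H))
    (hadj_vert : ∀ f : G,
      LinearMap.adjoint (ρ (∑ t : G, DGbasis t f)) = ρ (∑ t : G, DGbasis t f⁻¹))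
    (F : G → G → (H →ₗ[ℂ] H))
    (hFone : (∑ g : G, F 1 g) = 1)
    (hcomm_vert : ∀ f h g : G,
      ρ (∑ t : G, DGbasis t f) * F h g = F h (g * f⁻¹) * ρ (∑ t : G, DGbasis t f))
    (Ω : H) (hΩnorm : ‖Ω‖ = 1)
    (hΩ : ∀ f f' : G, ρ (DGbasis f f') Ω = (if f = 1 then (1 : ℂ) else 0) • Ω)
    (g : G) : ⟪Ω, F 1 g Ω⟫_ℂ = 1 / (Fintype.card G : ℂ) := by
  have hvac := vertex_apply_vacuum ρ Ω hΩ
  have hinv : ∀ f g : G, ⟪Ω, F 1 g Ω⟫_ℂ = ⟪Ω, F 1 (g * f⁻¹) Ω⟫_ℂ := fun f g => by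
    have hcomm := LinearMap.congr_fun (hcomm_vert f 1 g) Ω
    rw [Module.End.mul_apply, Module.End.mul_apply, hvac] at hcomm
    rw [← hcomm, ← LinearMap.adjoint_inner_left (ρ _), hadj_vert, hvac]
  have hconst : ∀ g' : G, ⟪Ω, F 1 g' Ω⟫_ℂ = ⟪Ω, F 1 g Ω⟫_ℂ := fun g' => by
    simpa using hinv (g⁻¹ * g') g'
  have hsum : ∑ g' : G, ⟪Ω, F 1 g' Ω⟫_ℂ = 1 := by
    rw [← inner_sum, ← LinearMap.sum_apply, hFone, Module.End.one_apply,
      inner_self_eq_norm_sq_to_K, hΩnorm]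
    simp
  rw [Finset.sum_congr rfl fun g' _ => hconst g', Finset.sum_const, Finset.card_univ,
    nsmul_eq_mul] at hsum
  exact eq_one_div_of_mul_eq_one_right hsum

theorem statement11
    (ρ : DoubleDG G →ₗ[ℂ] (H →ₗ[ℂ] H))
    (hρmul : ∀ x y : DoubleDG G, ρ (DGmul x y) = ρ x * ρ y)
    (hρone : ρ DGone = 1)
    (hadj_vert : ∀ f : G,
      LinearMap.adjoint (ρ (∑ t : G, DGbasis t f)) = ρ (∑ t : G, DGbasis t f⁻¹))
    (hadj_face : ∀ f : G,
      LinearMap.adjoint (ρ (DGbasis f 1)) = ρ (DGbasis f 1))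
    (F : G → G → (H →ₗ[ℂ] H))
    (hFmul : ∀ h h' g g' : G,
      F h g * F h' g' = if g = g' then F (h * h') g else 0)
    (hFone : (∑ g : G, F 1 g) = 1)
    (hFadj : ∀ h g : G, LinearMap.adjoint (F h g) = F h⁻¹ g)
    (hcomm_vert : ∀ f h g : G,
      ρ (∑ t : G, DGbasis t f) * F h g = F h (g * f⁻¹) * ρ (∑ t : G, DGbasis t f))
    (hcomm_face : ∀ f h g : G,
      ρ (DGbasis f 1) * F h g = F h g * ρ (DGbasis (f * (g⁻¹ * h * g)) 1))
    (Ω : H) (hΩnorm : ‖Ω‖ = 1)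
    (hΩ : ∀ f f' : G, ρ (DGbasis f f') Ω = (if f = 1 then (1 : ℂ) else 0) • Ω) :
    (∀ h h' g g' : G,
      ⟪F h g Ω, F h' g' Ω⟫_ℂ =
        (if h = h' ∧ g = g' then 1 else 0) / (Fintype.card G : ℂ)) ∧
    (∀ h h' g g' : G, (h, g) ≠ (h', g') → ⟪F h g Ω, F h' g' Ω⟫_ℂ = 0) ∧
    (∀ h g : G, F h g Ω ≠ 0) := by
  have hmain : ∀ h h' g g' : G,
      ⟪F h g Ω, F h' g' Ω⟫_ℂ =
        (if h = h' ∧ g = g' then 1 else 0) / (Fintype.card G : ℂ) := by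
    intro h h' g g'
    rw [← LinearMap.adjoint_inner_right, hFadj, ← Module.End.mul_apply, hFmul]
    by_cases hg : g = g'
    · rw [if_pos hg]
      by_cases hh : h = h'
      · rw [if_pos ⟨hh, hg⟩, hh, inv_mul_cancel]
        exact inner_vacuum_ribbon_one ρ hadj_vert F hFone hcomm_vert Ω hΩnorm hΩ g
      · rw [if_neg fun H => hh H.1, zero_div]
        exact inner_vacuum_ribbon_eq_zero ρ hadj_face F hcomm_face Ω hΩ
          (fun H => hh (inv_mul_eq_one.1 H)) g
    · rw [if_neg hg, if_neg fun H => hg H.2, LinearMap.zero_apply, inner_zero_right, zero_div]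
  refine ⟨hmain, fun h h' g g' hne => ?_, fun h g h0 => ?_⟩
  · rw [hmain, if_neg fun H => hne (Prod.ext H.1 H.2), zero_div]
  · have hself := hmain h h g g
    rw [h0, inner_zero_left, if_pos ⟨rfl, rfl⟩] at hself
    exact one_div_ne_zero (Nat.cast_ne_zero.2 Fintype.card_ne_zero) hself.symm

end
end

section
/- For all x, y ∈ D(G): ρ₀(x) Ψ(y) = Ψ(xy) and ρ₁(x) Ψ(y) = Ψ(y · S(x)); equivalently, f ▷_{s₀} F^{h,g}Ω = F^{fhf⁻¹, fg}Ω, δ_f ▷_{s₀} F^{h,g}Ω = [f = h] F^{h,g}Ω, f ▷_{s₁} F^{h,g}Ω = F^{h, gf⁻¹}Ω, and δ_f ▷_{s₁} F^{h,g}Ω = [f = g⁻¹h⁻¹g] F^{h,g}Ω. Thus Ψ identifies the span of the F^{h,g}Ω with D(G) carrying its left regular representation at s₀ and its right regular representation (via the antipode) at s₁. -/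
/-!
The ribbon states `F^{h,g}Ω` carry the left regular representation of `D(G)` at the
initial site `s₀` and the right regular representation (via the antipode) at the final
site `s₁`.
-/

noncomputable section

open scoped BigOperators

variable {G : Type*} [Group G] [Fintype G] [DecidableEq G]
variable {H : Type*} [AddCommGroup H] [Module ℂ H]

/-- The linear map `Ψ : D(G) → H`, `Ψ(δ_h ⊗ g) = F^{h,g} Ω`. -/
def PsiMap (F : G → G → Module.End ℂ H) (Ω : H) (y : DoubleDG G) : H :=
  ∑ h : G, ∑ g : G, y (h, g) • F h g Ω

/-- A linear map on `D(G)` is determined by its values on the basis `δ_s ⊗ f`. -/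
theorem map_eq_sum_DGbasis {G : Type*} [Fintype G] [DecidableEq G]
    {M : Type*} [AddCommGroup M] [Module ℂ M]
    (ρ : DoubleDG G →ₗ[ℂ] M) (x : DoubleDG G) :
    ρ x = ∑ f : G, ∑ s : G, x (s, f) • ρ (DGbasis s f) := by
  have hx : x = ∑ f : G, ∑ s : G, x (s, f) • DGbasis s f := by
    rw [← Fintype.sum_prod_type_right' fun s f => x (s, f) • DGbasis s f]
    funext p
    simp [DGbasis, Finset.sum_apply]
  conv_lhs => rw [hx]
  simp only [map_sum, map_smul]

/-- `δ_s ⊗ f = (δ_s ⊗ e) (∑ t, δ_t ⊗ f)`. -/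
theorem DGmul_DGbasis_one_sum (s f : G) :
    DGmul (DGbasis s 1) (∑ t : G, DGbasis t f) = DGbasis s f := by
  funext ⟨a, b⟩
  simp only [DGmul, DGbasis, Finset.sum_apply, Prod.mk.injEq]
  rw [Finset.sum_eq_single 1]
  · by_cases ha : a = s <;> by_cases hb : b = f <;> simp [ha, hb]
  · intro k _ hk
    simp [hk]
  · simp

/-- A representation of `D(G)` acts on any vector by summing the combined vertex and face
actions. -/
theorem rep_apply_eq_sum (ρ : DoubleDG G →ₗ[ℂ] Module.End ℂ H)
    (hmul : ∀ x y : DoubleDG G, ρ (DGmul x y) = ρ x * ρ y) (x : DoubleDG G) (v : H) :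
    ρ x v = ∑ f : G, ∑ s : G,
      x (s, f) • ρ (DGbasis s 1) (ρ (∑ t : G, DGbasis t f) v) := by
  rw [map_eq_sum_DGbasis ρ x]
  simp only [LinearMap.sum_apply, LinearMap.smul_apply, ← Module.End.mul_apply, ← hmul,
    DGmul_DGbasis_one_sum]

/-- The vertex action fixes a vector on which `D(G)` acts by the counit. -/
theorem rep_vertex_apply_of_counit (ρ : DoubleDG G →ₗ[ℂ] Module.End ℂ H) (Ω : H)
    (hΩ : ∀ f f' : G, ρ (DGbasis f f') Ω = (if f = 1 then (1 : ℂ) else 0) • Ω) (f : G) :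
    ρ (∑ t : G, DGbasis t f) Ω = Ω := by
  simp [map_sum, LinearMap.sum_apply, hΩ]

/-- Left multiplication in `D(G)`, transported along `Ψ`. -/
theorem PsiMap_DGmul {G : Type*} [Group G] [Fintype G]
    (F : G → G → Module.End ℂ H) (Ω : H) (x y : DoubleDG G) :
    PsiMap F Ω (DGmul x y) = ∑ f : G, ∑ h : G, ∑ g : G,
      (x (f * h * f⁻¹, f) * y (h, g)) • F (f * h * f⁻¹) (f * g) Ω := by
  simp only [PsiMap, DGmul, Finset.sum_smul]
  rw [Finset.sum_congr rfl fun h _ => Finset.sum_comm, Finset.sum_comm]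
  refine Finset.sum_congr rfl fun f _ => ?_
  refine (Fintype.sum_equiv (MulAut.conj f).toEquiv _ _ fun h => ?_).symm
  refine Fintype.sum_equiv (Equiv.mulLeft f) _ _ fun g => ?_
  simp [mul_assoc]

/-- Right multiplication by an antipode in `D(G)`, transported along `Ψ`. -/
theorem PsiMap_DGmul_DGantipode {G : Type*} [Group G] [Fintype G]
    (F : G → G → Module.End ℂ H) (Ω : H) (x y : DoubleDG G) :
    PsiMap F Ω (DGmul y (DGantipode x)) = ∑ f : G, ∑ h : G, ∑ g : G,
      (x ((g * f⁻¹)⁻¹ * h⁻¹ * (g * f⁻¹), f) * y (h, g)) • F h (g * f⁻¹) Ω := by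
  simp only [PsiMap, DGmul, DGantipode, Finset.sum_smul]
  rw [Finset.sum_comm (s := Finset.univ (α := G))
    (f := fun f h => ∑ g : G, (x ((g * f⁻¹)⁻¹ * h⁻¹ * (g * f⁻¹), f) * y (h, g)) •
      F h (g * f⁻¹) Ω)]
  refine Finset.sum_congr rfl fun h _ => ?_
  rw [Finset.sum_comm, Finset.sum_comm (s := Finset.univ (α := G))
    (f := fun f g => (x ((g * f⁻¹)⁻¹ * h⁻¹ * (g * f⁻¹), f) * y (h, g)) • F h (g * f⁻¹) Ω)]
  refine Finset.sum_congr rfl fun g _ => ?_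
  refine (Fintype.sum_equiv ((Equiv.inv G).trans (Equiv.mulLeft g)) _ _ fun f => ?_).symm
  simp [mul_assoc, mul_comm (y _)]

theorem statement12
    (ρ₀ ρ₁ : DoubleDG G →ₗ[ℂ] Module.End ℂ H)
    (hρ₀mul : ∀ x y : DoubleDG G, ρ₀ (DGmul x y) = ρ₀ x * ρ₀ y)
    (hρ₀one : ρ₀ DGone = 1)
    (hρ₁mul : ∀ x y : DoubleDG G, ρ₁ (DGmul x y) = ρ₁ x * ρ₁ y)
    (hρ₁one : ρ₁ DGone = 1)
    (F : G → G → Module.End ℂ H)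
    (hcomm₀vert : ∀ f h g : G,
      ρ₀ (∑ t : G, DGbasis t f) * F h g =
        F (f * h * f⁻¹) (f * g) * ρ₀ (∑ t : G, DGbasis t f))
    (hcomm₀face : ∀ f h g : G,
      ρ₀ (DGbasis f 1) * F h g = F h g * ρ₀ (DGbasis (h⁻¹ * f) 1))
    (hcomm₁vert : ∀ f h g : G,
      ρ₁ (∑ t : G, DGbasis t f) * F h g =
        F h (g * f⁻¹) * ρ₁ (∑ t : G, DGbasis t f))
    (hcomm₁face : ∀ f h g : G,
      ρ₁ (DGbasis f 1) * F h g = F h g * ρ₁ (DGbasis (f * (g⁻¹ * h * g)) 1))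
    (Ω : H)
    (hΩ₀ : ∀ f f' : G, ρ₀ (DGbasis f f') Ω = (if f = 1 then (1 : ℂ) else 0) • Ω)
    (hΩ₁ : ∀ f f' : G, ρ₁ (DGbasis f f') Ω = (if f = 1 then (1 : ℂ) else 0) • Ω) :
    (∀ x y : DoubleDG G, ρ₀ x (PsiMap F Ω y) = PsiMap F Ω (DGmul x y)) ∧
    (∀ x y : DoubleDG G, ρ₁ x (PsiMap F Ω y) = PsiMap F Ω (DGmul y (DGantipode x))) ∧
    (∀ f h g : G, ρ₀ (∑ t : G, DGbasis t f) (F h g Ω) = F (f * h * f⁻¹) (f * g) Ω) ∧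
    (∀ f h g : G,
      ρ₀ (DGbasis f 1) (F h g Ω) = (if f = h then (1 : ℂ) else 0) • F h g Ω) ∧
    (∀ f h g : G, ρ₁ (∑ t : G, DGbasis t f) (F h g Ω) = F h (g * f⁻¹) Ω) ∧
    (∀ f h g : G,
      ρ₁ (DGbasis f 1) (F h g Ω) =
        (if f = g⁻¹ * h⁻¹ * g then (1 : ℂ) else 0) • F h g Ω) := by
  have vert₀ : ∀ f h g : G,
      ρ₀ (∑ t : G, DGbasis t f) (F h g Ω) = F (f * h * f⁻¹) (f * g) Ω := fun f h g => by
    rw [← Module.End.mul_apply, hcomm₀vert, Module.End.mul_apply,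
      rep_vertex_apply_of_counit ρ₀ Ω hΩ₀]
  have vert₁ : ∀ f h g : G,
      ρ₁ (∑ t : G, DGbasis t f) (F h g Ω) = F h (g * f⁻¹) Ω := fun f h g => by
    rw [← Module.End.mul_apply, hcomm₁vert, Module.End.mul_apply,
      rep_vertex_apply_of_counit ρ₁ Ω hΩ₁]
  have face₀ : ∀ f h g : G,
      ρ₀ (DGbasis f 1) (F h g Ω) = (if f = h then (1 : ℂ) else 0) • F h g Ω := fun f h g => by
    rw [← Module.End.mul_apply, hcomm₀face, Module.End.mul_apply, hΩ₀, map_smul]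
    simp only [inv_mul_eq_one, eq_comm]
  have face₁ : ∀ f h g : G,
      ρ₁ (DGbasis f 1) (F h g Ω) =
        (if f = g⁻¹ * h⁻¹ * g then (1 : ℂ) else 0) • F h g Ω := fun f h g => by
    rw [← Module.End.mul_apply, hcomm₁face, Module.End.mul_apply, hΩ₁, map_smul]
    simp only [mul_eq_one_iff_eq_inv, mul_inv_rev, inv_inv, mul_assoc]
  refine ⟨fun x y => ?_, fun x y => ?_, vert₀, face₀, vert₁, face₁⟩
  · rw [rep_apply_eq_sum ρ₀ hρ₀mul, PsiMap_DGmul]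
    refine Finset.sum_congr rfl fun f _ => ?_
    simp only [PsiMap, map_sum (ρ₀ _), map_smul (ρ₀ _), vert₀, face₀, Finset.smul_sum]
    rw [Finset.sum_comm]
    refine Finset.sum_congr rfl fun h _ => ?_
    rw [Finset.sum_comm]
    refine Finset.sum_congr rfl fun g _ => ?_
    simp [smul_smul]
  · rw [rep_apply_eq_sum ρ₁ hρ₁mul, PsiMap_DGmul_DGantipode]
    refine Finset.sum_congr rfl fun f _ => ?_
    simp only [PsiMap, map_sum (ρ₁ _), map_smul (ρ₁ _), vert₁, face₁, Finset.smul_sum]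
    rw [Finset.sum_comm]
    refine Finset.sum_congr rfl fun h _ => ?_
    rw [Finset.sum_comm]
    refine Finset.sum_congr rfl fun g _ => ?_
    simp [smul_smul]

end
end

section
/- If P ∈ D(G) is central, then ρ₀(P) Ψ(y) = ρ₁(S(P)) Ψ(y) for all y ∈ D(G). In particular, for the state |Bell⟩ := Σ_{h∈G} F^{h,e}Ω = Ψ(1), one has ρ₀(P)|Bell⟩ = ρ₁(S(P))|Bell⟩ = Ψ(P): a central projection detected at the initial end of the ribbon is automatically detected at the final end. -/
/-!
Ribbon teleportation: for a central element `P` of `D(G)`,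
`ρ₀(P) Ψ(y) = ρ₁(S(P)) Ψ(y)`, and in particular the Bell state
`|Bell⟩ = Σ_h F^{h,e}Ω = Ψ(1)` satisfies `ρ₀(P)|Bell⟩ = ρ₁(S(P))|Bell⟩ = Ψ(P)`.
-/

noncomputable section

open scoped BigOperators

variable {G : Type*} [Group G] [Fintype G] [DecidableEq G]
variable {H : Type*} [AddCommGroup H] [Module ℂ H]

omit [Group G] in
theorem map_apply_eq_sum_DGbasis (ρ : DoubleDG G →ₗ[ℂ] Module.End ℂ H) (x : DoubleDG G) (v : H) :
    ρ x v = ∑ a : G, ∑ s : G, x (s, a) • ρ (DGbasis s a) v := by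
  have hx : x = ∑ a : G, ∑ s : G, x (s, a) • DGbasis s a := by
    ext ⟨s, a⟩
    simp [DGbasis, ite_and]
  conv_lhs => rw [hx]
  simp [map_sum]

theorem DGmul_DGbasis_one_sum_DGbasis (f a : G) :
    DGmul (DGbasis f 1) (∑ t : G, DGbasis t a) = DGbasis f a := by
  ext ⟨s, b⟩
  simp only [DGmul]
  rw [Fintype.sum_eq_single 1 fun x hx => by simp [DGbasis, hx]]
  simp only [DGbasis, Finset.sum_apply]
  by_cases hs : s = f <;> simp [hs, ite_and]

omit [Fintype G] [DecidableEq G] in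
theorem DGantipode_DGantipode (x : DoubleDG G) : DGantipode (DGantipode x) = x := by
  ext ⟨s, a⟩
  simp [DGantipode, mul_assoc]

theorem DGone_DGmul (x : DoubleDG G) : DGmul DGone x = x := by
  ext ⟨s, a⟩
  simp [DGmul, DGone]

theorem PsiMap_DGone (F : G → G → Module.End ℂ H) (Ω : H) :
    PsiMap F Ω DGone = ∑ h : G, F h 1 Ω := by
  simp [PsiMap, DGone]

/-- If `δ_f` and `a` can be moved past the operators `T` and `T'`, then the basis element
`δ_f ⊗ a` acts on `T Ω`, for `Ω` spanning a trivial representation, as a projection onto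
`T' Ω`. -/
theorem map_DGbasis_apply_of_commute (ρ : DoubleDG G →ₗ[ℂ] Module.End ℂ H)
    (hmul : ∀ x y : DoubleDG G, ρ (DGmul x y) = ρ x * ρ y) (Ω : H)
    (hΩ : ∀ f a : G, ρ (DGbasis f a) Ω = (if f = 1 then (1 : ℂ) else 0) • Ω)
    {f a f' : G} {T T' : Module.End ℂ H}
    (hvert : ρ (∑ t : G, DGbasis t a) * T = T' * ρ (∑ t : G, DGbasis t a))
    (hface : ρ (DGbasis f 1) * T' = T' * ρ (DGbasis f' 1)) :
    ρ (DGbasis f a) (T Ω) = if f' = 1 then T' Ω else 0 := by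
  have hvac : ρ (∑ t : G, DGbasis t a) Ω = Ω := by
    simp [map_sum, LinearMap.sum_apply, hΩ]
  rw [← DGmul_DGbasis_one_sum_DGbasis, hmul, ← Module.End.mul_apply, mul_assoc, hvert,
    ← mul_assoc, Module.End.mul_apply, hvac, hface, Module.End.mul_apply, hΩ]
  split_ifs <;> simp

/-- At the initial end of the ribbon, `D(G)` acts by left multiplication. -/
theorem apply_PsiMap_eq_PsiMap_DGmul (ρ : DoubleDG G →ₗ[ℂ] Module.End ℂ H)
    (hmul : ∀ x y : DoubleDG G, ρ (DGmul x y) = ρ x * ρ y)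
    (F : G → G → Module.End ℂ H)
    (hvert : ∀ f h g : G,
      ρ (∑ t : G, DGbasis t f) * F h g =
        F (f * h * f⁻¹) (f * g) * ρ (∑ t : G, DGbasis t f))
    (hface : ∀ f h g : G,
      ρ (DGbasis f 1) * F h g = F h g * ρ (DGbasis (h⁻¹ * f) 1))
    (Ω : H)
    (hΩ : ∀ f a : G, ρ (DGbasis f a) Ω = (if f = 1 then (1 : ℂ) else 0) • Ω)
    (x y : DoubleDG G) :
    ρ x (PsiMap F Ω y) = PsiMap F Ω (DGmul x y) := by
  have key (h g : G) : ρ x (F h g Ω) =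
      ∑ a : G, x (a * h * a⁻¹, a) • F (a * h * a⁻¹) (a * g) Ω := by
    rw [map_apply_eq_sum_DGbasis]
    refine Finset.sum_congr rfl fun a _ => ?_
    simp only [map_DGbasis_apply_of_commute ρ hmul Ω hΩ (hvert a h g) (hface _ _ _),
      inv_mul_eq_one]
    simp
  simp only [PsiMap, DGmul, map_sum, map_smul, key, Finset.smul_sum, Finset.sum_smul]
  calc
    _ = ∑ h : G, ∑ a : G, ∑ g : G,
          y (h, g) • x (a * h * a⁻¹, a) • F (a * h * a⁻¹) (a * g) Ω :=
        Finset.sum_congr rfl fun _ _ => Finset.sum_comm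
    _ = ∑ a : G, ∑ h : G, ∑ g : G,
          y (h, g) • x (a * h * a⁻¹, a) • F (a * h * a⁻¹) (a * g) Ω := Finset.sum_comm
    _ = ∑ a : G, ∑ s : G, ∑ k : G,
          (x (s, a) * y (a⁻¹ * s * a, a⁻¹ * k)) • F s k Ω := by
        refine Finset.sum_congr rfl fun a _ => ?_
        refine Fintype.sum_equiv (MulAut.conj a).toEquiv _ _ fun h => ?_
        refine Fintype.sum_equiv (Equiv.mulLeft a) _ _ fun g => ?_
        simp [smul_smul, mul_assoc, mul_comm (y _)]
    _ = ∑ s : G, ∑ a : G, ∑ k : G,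
          (x (s, a) * y (a⁻¹ * s * a, a⁻¹ * k)) • F s k Ω := Finset.sum_comm
    _ = _ := Finset.sum_congr rfl fun _ _ => Finset.sum_comm

/-- At the final end of the ribbon, `D(G)` acts by right multiplication twisted by the
antipode. -/
theorem apply_PsiMap_eq_PsiMap_DGmul_DGantipode (ρ : DoubleDG G →ₗ[ℂ] Module.End ℂ H)
    (hmul : ∀ x y : DoubleDG G, ρ (DGmul x y) = ρ x * ρ y)
    (F : G → G → Module.End ℂ H)
    (hvert : ∀ f h g : G,
      ρ (∑ t : G, DGbasis t f) * F h g = F h (g * f⁻¹) * ρ (∑ t : G, DGbasis t f))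
    (hface : ∀ f h g : G,
      ρ (DGbasis f 1) * F h g = F h g * ρ (DGbasis (f * (g⁻¹ * h * g)) 1))
    (Ω : H)
    (hΩ : ∀ f a : G, ρ (DGbasis f a) Ω = (if f = 1 then (1 : ℂ) else 0) • Ω)
    (x y : DoubleDG G) :
    ρ x (PsiMap F Ω y) = PsiMap F Ω (DGmul y (DGantipode x)) := by
  have key (h g : G) : ρ x (F h g Ω) =
      ∑ k : G, x ((k⁻¹ * h * k)⁻¹, k⁻¹ * g) • F h k Ω := by
    rw [map_apply_eq_sum_DGbasis]
    refine Fintype.sum_equiv ((Equiv.inv G).trans (Equiv.mulLeft g)) _ _ fun a => ?_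
    simp only [map_DGbasis_apply_of_commute ρ hmul Ω hΩ (hvert a h g) (hface _ _ _),
      mul_eq_one_iff_eq_inv]
    simp
  simp only [PsiMap, DGmul, DGantipode, map_sum, map_smul, key, Finset.smul_sum,
    Finset.sum_smul, smul_smul]
  refine Finset.sum_congr rfl fun h _ => ?_
  rw [Finset.sum_comm]
  simp [mul_assoc]

theorem statement13
    (ρ₀ ρ₁ : DoubleDG G →ₗ[ℂ] Module.End ℂ H)
    (hρ₀mul : ∀ x y : DoubleDG G, ρ₀ (DGmul x y) = ρ₀ x * ρ₀ y)
    (hρ₀one : ρ₀ DGone = 1)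
    (hρ₁mul : ∀ x y : DoubleDG G, ρ₁ (DGmul x y) = ρ₁ x * ρ₁ y)
    (hρ₁one : ρ₁ DGone = 1)
    (F : G → G → Module.End ℂ H)
    (hcomm₀vert : ∀ f h g : G,
      ρ₀ (∑ t : G, DGbasis t f) * F h g =
        F (f * h * f⁻¹) (f * g) * ρ₀ (∑ t : G, DGbasis t f))
    (hcomm₀face : ∀ f h g : G,
      ρ₀ (DGbasis f 1) * F h g = F h g * ρ₀ (DGbasis (h⁻¹ * f) 1))
    (hcomm₁vert : ∀ f h g : G,
      ρ₁ (∑ t : G, DGbasis t f) * F h g =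
        F h (g * f⁻¹) * ρ₁ (∑ t : G, DGbasis t f))
    (hcomm₁face : ∀ f h g : G,
      ρ₁ (DGbasis f 1) * F h g = F h g * ρ₁ (DGbasis (f * (g⁻¹ * h * g)) 1))
    (Ω : H)
    (hΩ₀ : ∀ f f' : G, ρ₀ (DGbasis f f') Ω = (if f = 1 then (1 : ℂ) else 0) • Ω)
    (hΩ₁ : ∀ f f' : G, ρ₁ (DGbasis f f') Ω = (if f = 1 then (1 : ℂ) else 0) • Ω)
    (P : DoubleDG G)
    (hP : ∀ x : DoubleDG G, DGmul P x = DGmul x P) :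
    (∀ y : DoubleDG G, ρ₀ P (PsiMap F Ω y) = ρ₁ (DGantipode P) (PsiMap F Ω y)) ∧
    ρ₀ P (∑ h : G, F h 1 Ω) = PsiMap F Ω P ∧
    ρ₁ (DGantipode P) (∑ h : G, F h 1 Ω) = PsiMap F Ω P ∧
    PsiMap F Ω DGone = ∑ h : G, F h 1 Ω := by
  have h₀ := apply_PsiMap_eq_PsiMap_DGmul ρ₀ hρ₀mul F hcomm₀vert hcomm₀face Ω hΩ₀
  have h₁ (y : DoubleDG G) :
      ρ₁ (DGantipode P) (PsiMap F Ω y) = PsiMap F Ω (DGmul P y) := by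
    rw [apply_PsiMap_eq_PsiMap_DGmul_DGantipode ρ₁ hρ₁mul F hcomm₁vert hcomm₁face Ω hΩ₁,
      DGantipode_DGantipode, hP]
  have hPone : DGmul P DGone = P := (hP DGone).trans (DGone_DGmul P)
  refine ⟨fun y => (h₀ P y).trans (h₁ y).symm, ?_, ?_, PsiMap_DGone F Ω⟩
  · rw [← PsiMap_DGone, h₀, hPone]
  · rw [← PsiMap_DGone, h₁, hPone]

end
end

section
/- The linear map F̃ : D(G)* → End(H) defined on the basis by F̃(h ⊗ δ_g) = F^{h⁻¹, g} is a map of D(G)-bimodules: F̃(d ▷ φ) = d ▷ F̃(φ) and F̃(φ ◁ d) = F̃(φ) ◁ d for all d ∈ D(G) and φ ∈ D(G)*. -/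
/-!
The ribbon operator map `F̃ : D(G)* → End(H)`, `F̃(h ⊗ δ_g) = F^{h⁻¹,g}`, is a map of
`D(G)`-bimodules for the coregular actions on `D(G)*` and the actions on `End(H)`
induced by the site actions at the two ends of the ribbon.
-/

noncomputable section

open scoped BigOperators

variable {G : Type*} [Group G] [Fintype G] [DecidableEq G]
variable {H : Type*} [AddCommGroup H] [Module ℂ H]

/-- The coregular left action of `D(G)` on `D(G)*`: `(d ▷ φ)(x) = φ(S(d) x)`, written
in coordinates with respect to the basis `{h ⊗ δ_g}` of `D(G)*` dual to `{δ_h ⊗ g}`. -/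
def coregLeft {G : Type*} [Group G] [Fintype G] [DecidableEq G]
    (d φ : DoubleDG G) : DoubleDG G :=
  fun p => ∑ s : G, ∑ k : G, φ (s, k) * DGmul (DGantipode d) (DGbasis p.1 p.2) (s, k)

/-- The coregular right action of `D(G)` on `D(G)*`: `(φ ◁ d)(x) = φ(x S(d))`. -/
def coregRight {G : Type*} [Group G] [Fintype G] [DecidableEq G]
    (φ d : DoubleDG G) : DoubleDG G :=
  fun p => ∑ s : G, ∑ k : G, φ (s, k) * DGmul (DGbasis p.1 p.2) (DGantipode d) (s, k)

/-- The left action of `D(G)` on `End(H)`: `d ▷ L = Σ ρ₀(d₁) ∘ L ∘ ρ₀(S d₂)`, using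
the coproduct `Δ(δ_g ⊗ h) = Σ_t (δ_t ⊗ h) ⊗ (δ_{t⁻¹g} ⊗ h)`. -/
def hitLeft (ρ₀ : DoubleDG G →ₗ[ℂ] Module.End ℂ H) (d : DoubleDG G)
    (L : Module.End ℂ H) : Module.End ℂ H :=
  ∑ t : G, ∑ u : G, ∑ h : G,
    d (t * u, h) • (ρ₀ (DGbasis t h) * L * ρ₀ (DGbasis (h⁻¹ * u⁻¹ * h) h⁻¹))

/-- The right action of `D(G)` on `End(H)`: `L ◁ d = Σ ρ₁(S d₁) ∘ L ∘ ρ₁(d₂)`. -/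
def hitRight (ρ₁ : DoubleDG G →ₗ[ℂ] Module.End ℂ H) (d : DoubleDG G)
    (L : Module.End ℂ H) : Module.End ℂ H :=
  ∑ t : G, ∑ u : G, ∑ h : G,
    d (t * u, h) • (ρ₁ (DGbasis (h⁻¹ * t⁻¹ * h) h⁻¹) * L * ρ₁ (DGbasis u h))

/-- The linear map `F̃ : D(G)* → End(H)` with `F̃(h ⊗ δ_g) = F^{h⁻¹,g}`. -/
def Ftilde (F : G → G → Module.End ℂ H) (φ : DoubleDG G) : Module.End ℂ H :=
  ∑ h : G, ∑ g : G, φ (h, g) • F h⁻¹ g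

/-- The element `Σ_t δ_t ⊗ f` of `D(G)`, through which `f : G` acts at a site. -/
def DGvert {G : Type*} [Fintype G] [DecidableEq G] (f : G) : DoubleDG G :=
  ∑ t : G, DGbasis t f

lemma DGvert_apply {G : Type*} [Fintype G] [DecidableEq G] (f : G) (p : G × G) :
    DGvert f p = if p.2 = f then 1 else 0 := by
  simp [DGvert, DGbasis, Finset.sum_apply, Prod.ext_iff, ite_and]

lemma DGmul_basis_left (s h : G) (y : DoubleDG G) (p : G × G) :
    DGmul (DGbasis s h) y p = if p.1 = s then y (h⁻¹ * s * h, h⁻¹ * p.2) else 0 := by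
  by_cases hp : p.1 = s
  · simp [DGmul, DGbasis, Prod.ext_iff, hp]
  · simp [DGmul, DGbasis, Prod.ext_iff, hp]

lemma DGmul_basis_vert (s h : G) : DGmul (DGbasis s 1) (DGvert h) = DGbasis s h := by
  funext p
  simp [DGmul_basis_left, DGvert_apply, DGbasis, Prod.ext_iff, ite_and]

lemma DGmul_vert_basis (b s c : G) :
    DGmul (DGvert b) (DGbasis s c) = DGbasis (b * s * b⁻¹) (b * c) := by
  funext p
  have h₁ : b⁻¹ * p.1 * b = s ↔ p.1 = b * s * b⁻¹ := by
    rw [eq_mul_inv_iff_mul_eq, ← inv_mul_eq_iff_eq_mul, mul_assoc]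
  have h₂ : b⁻¹ * p.2 = c ↔ p.2 = b * c := inv_mul_eq_iff_eq_mul
  simp only [DGmul, DGvert_apply, ite_mul, one_mul, zero_mul, Finset.sum_ite_eq',
    Finset.mem_univ, if_true, DGbasis, Prod.ext_iff, h₁, h₂]

lemma DGmul_face_face (s t : G) :
    DGmul (DGbasis s 1) (DGbasis t 1) = if s = t then DGbasis s 1 else 0 := by
  funext p
  rw [DGmul_basis_left]
  by_cases hst : s = t <;> by_cases hp : p.1 = s <;>
    simp [DGbasis, Prod.ext_iff, hst, hp]
  all_goals simp_all

lemma sum_DGbasis_one : ∑ s : G, DGbasis s (1 : G) = DGone := by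
  funext p
  exact DGvert_apply 1 p

lemma coregLeft_apply (d φ : DoubleDG G) (p q : G) :
    coregLeft d φ (p, q) = ∑ b : G, φ (b⁻¹ * p * b, b⁻¹ * q) * d (p⁻¹, b) := by
  have key (s k b : G) : DGbasis p q ((b * s * b⁻¹, b * k) : G × G) =
      if s = b⁻¹ * p * b then if k = b⁻¹ * q then 1 else 0 else 0 := by
    have h₁ : b * s * b⁻¹ = p ↔ s = b⁻¹ * p * b := by
      rw [mul_inv_eq_iff_eq_mul, mul_assoc, ← eq_inv_mul_iff_mul_eq]
    have h₂ : b * k = q ↔ k = b⁻¹ * q := by rw [← eq_inv_mul_iff_mul_eq]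
    simp [DGbasis, Prod.ext_iff, h₁, h₂, ite_and]
  calc coregLeft d φ (p, q)
      = ∑ s : G, ∑ k : G, ∑ b : G,
          φ (s, k) * (d (b * s⁻¹ * b⁻¹, b) * DGbasis p q (b * s * b⁻¹, b * k)) := by
        refine Finset.sum_congr rfl fun s _ => Finset.sum_congr rfl fun k _ => ?_
        rw [DGmul, Finset.mul_sum, ← Equiv.sum_comp (Equiv.inv G)]
        simp [DGantipode]
    _ = ∑ b : G, ∑ s : G, ∑ k : G,
          φ (s, k) * (d (b * s⁻¹ * b⁻¹, b) * DGbasis p q (b * s * b⁻¹, b * k)) := by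
        rw [Finset.sum_comm_cycle]
    _ = _ := by
        refine Finset.sum_congr rfl fun b _ => ?_
        simp only [key]
        simp [mul_assoc]

lemma coregRight_apply (d φ : DoubleDG G) (p q : G) :
    coregRight φ d (p, q) = ∑ b : G, φ (p, q * b⁻¹) * d (b * q⁻¹ * p⁻¹ * q * b⁻¹, b) := by
  have key (k : G) : DGantipode d (q⁻¹ * p * q, q⁻¹ * k) =
      d (k⁻¹ * p⁻¹ * k, k⁻¹ * q) := by
    simp [DGantipode, mul_assoc]
  simp only [coregRight, DGmul_basis_left, key]
  rw [Finset.sum_eq_single p (by intro s _ hs; simp [hs]) (by simp)]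
  rw [← Equiv.sum_comp ((Equiv.inv G).trans (Equiv.mulLeft q))]
  simp [mul_assoc]

lemma map_DGbasis (ρ : DoubleDG G →ₗ[ℂ] Module.End ℂ H)
    (hmul : ∀ x y : DoubleDG G, ρ (DGmul x y) = ρ x * ρ y)
    (s h : G) : ρ (DGbasis s h) = ρ (DGbasis s 1) * ρ (DGvert h) := by
  rw [← hmul, DGmul_basis_vert]

lemma map_face_mul_face (ρ : DoubleDG G →ₗ[ℂ] Module.End ℂ H)
    (hmul : ∀ x y : DoubleDG G, ρ (DGmul x y) = ρ x * ρ y)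
    (s t : G) :
    ρ (DGbasis s 1) * ρ (DGbasis t 1) = if s = t then ρ (DGbasis s 1) else 0 := by
  rw [← hmul, DGmul_face_face, apply_ite ρ, map_zero]

lemma map_vert_mul_basis_inv (ρ : DoubleDG G →ₗ[ℂ] Module.End ℂ H)
    (hmul : ∀ x y : DoubleDG G, ρ (DGmul x y) = ρ x * ρ y)
    (b s : G) :
    ρ (DGvert b) * ρ (DGbasis s b⁻¹) = ρ (DGbasis (b * s * b⁻¹) 1) := by
  rw [← hmul, DGmul_vert_basis, mul_inv_cancel]

lemma left_conj_ribbon (ρ : DoubleDG G →ₗ[ℂ] Module.End ℂ H)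
    (hmul : ∀ x y : DoubleDG G, ρ (DGmul x y) = ρ x * ρ y)
    (F : G → G → Module.End ℂ H)
    (vert : ∀ f h g : G, ρ (DGvert f) * F h g = F (f * h * f⁻¹) (f * g) * ρ (DGvert f))
    (face : ∀ f h g : G, ρ (DGbasis f 1) * F h g = F h g * ρ (DGbasis (h⁻¹ * f) 1))
    (t u b h g : G) :
    ρ (DGbasis t b) * F h g * ρ (DGbasis (b⁻¹ * u⁻¹ * b) b⁻¹) =
      if t = b * h * b⁻¹ * u⁻¹ then F (b * h * b⁻¹) (b * g) * ρ (DGbasis u⁻¹ 1) else 0 := by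
  have hu : b * (b⁻¹ * u⁻¹ * b) * b⁻¹ = u⁻¹ := by group
  have hiff : (b * h * b⁻¹)⁻¹ * t = u⁻¹ ↔ t = b * h * b⁻¹ * u⁻¹ := inv_mul_eq_iff_eq_mul
  rw [map_DGbasis ρ hmul t b, mul_assoc (ρ _), vert, ← mul_assoc, face, mul_assoc, mul_assoc,
    map_vert_mul_basis_inv ρ hmul, hu, map_face_mul_face ρ hmul]
  simp only [hiff, mul_ite, mul_zero]
  split_ifs with ht
  · rw [hiff.2 ht]
  · rfl

lemma right_conj_ribbon (ρ : DoubleDG G →ₗ[ℂ] Module.End ℂ H)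
    (hmul : ∀ x y : DoubleDG G, ρ (DGmul x y) = ρ x * ρ y)
    (F : G → G → Module.End ℂ H)
    (vert : ∀ f h g : G, ρ (DGvert f) * F h g = F h (g * f⁻¹) * ρ (DGvert f))
    (face : ∀ f h g : G,
      ρ (DGbasis f 1) * F h g = F h g * ρ (DGbasis (f * (g⁻¹ * h * g)) 1))
    (t u b h g : G) :
    ρ (DGbasis (b⁻¹ * t⁻¹ * b) b⁻¹) * F h g * ρ (DGbasis u b) =
      if t = g⁻¹ * h * g * u⁻¹ then F h (g * b) * ρ (DGbasis (b⁻¹ * u * b) 1) else 0 := by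
  have hv : ρ (DGvert b⁻¹) * ρ (DGbasis u b) = ρ (DGbasis (b⁻¹ * u * b) 1) := by
    simpa using map_vert_mul_basis_inv ρ hmul b⁻¹ u
  have hiff : b⁻¹ * t⁻¹ * b * ((g * b)⁻¹ * h * (g * b)) = b⁻¹ * u * b ↔
      t = g⁻¹ * h * g * u⁻¹ := by
    have e : b⁻¹ * t⁻¹ * b * ((g * b)⁻¹ * h * (g * b)) =
        b⁻¹ * (t⁻¹ * (g⁻¹ * h * g)) * b := by group
    rw [e, mul_left_inj, mul_right_inj, inv_mul_eq_iff_eq_mul, eq_mul_inv_iff_mul_eq, eq_comm]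
  rw [map_DGbasis ρ hmul _ b⁻¹, mul_assoc (ρ _), vert, inv_inv, ← mul_assoc, face, mul_assoc,
    mul_assoc, hv, map_face_mul_face ρ hmul]
  simp only [hiff, mul_ite, mul_zero]
  split_ifs with ht
  · rw [hiff.2 ht]
  · rfl

lemma sum_map_face (ρ : DoubleDG G →ₗ[ℂ] Module.End ℂ H)
    (hone : ρ DGone = 1) (e : G ≃ G) :
    ∑ u : G, ρ (DGbasis (e u) 1) = 1 := by
  rw [Equiv.sum_comp e fun u => ρ (DGbasis u 1), ← map_sum, sum_DGbasis_one, hone]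

lemma hitLeft_ribbon (ρ : DoubleDG G →ₗ[ℂ] Module.End ℂ H)
    (hmul : ∀ x y : DoubleDG G, ρ (DGmul x y) = ρ x * ρ y)
    (hone : ρ DGone = 1) (F : G → G → Module.End ℂ H)
    (vert : ∀ f h g : G, ρ (DGvert f) * F h g = F (f * h * f⁻¹) (f * g) * ρ (DGvert f))
    (face : ∀ f h g : G, ρ (DGbasis f 1) * F h g = F h g * ρ (DGbasis (h⁻¹ * f) 1))
    (d : DoubleDG G) (h g : G) :
    hitLeft ρ d (F h g) =
      ∑ b : G, d (b * h * b⁻¹, b) • F (b * h * b⁻¹) (b * g) := by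
  simp only [hitLeft, left_conj_ribbon ρ hmul F vert face]
  rw [Finset.sum_comm_cycle]
  refine Finset.sum_congr rfl fun b _ => ?_
  rw [Finset.sum_comm]
  simp only [smul_ite, smul_zero, Finset.sum_ite_eq', Finset.mem_univ, if_true,
    inv_mul_cancel_right]
  rw [← Finset.smul_sum, ← Finset.mul_sum]
  have hsum := sum_map_face ρ hone (Equiv.inv G)
  simp only [Equiv.inv_apply] at hsum
  rw [hsum, mul_one]

lemma hitRight_ribbon (ρ : DoubleDG G →ₗ[ℂ] Module.End ℂ H)
    (hmul : ∀ x y : DoubleDG G, ρ (DGmul x y) = ρ x * ρ y)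
    (hone : ρ DGone = 1) (F : G → G → Module.End ℂ H)
    (vert : ∀ f h g : G, ρ (DGvert f) * F h g = F h (g * f⁻¹) * ρ (DGvert f))
    (face : ∀ f h g : G,
      ρ (DGbasis f 1) * F h g = F h g * ρ (DGbasis (f * (g⁻¹ * h * g)) 1))
    (d : DoubleDG G) (h g : G) :
    hitRight ρ d (F h g) = ∑ b : G, d (g⁻¹ * h * g, b) • F h (g * b) := by
  simp only [hitRight, right_conj_ribbon ρ hmul F vert face]
  rw [Finset.sum_comm_cycle]
  refine Finset.sum_congr rfl fun b _ => ?_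
  rw [Finset.sum_comm]
  simp only [smul_ite, smul_zero, Finset.sum_ite_eq', Finset.mem_univ, if_true,
    inv_mul_cancel_right]
  rw [← Finset.smul_sum, ← Finset.mul_sum]
  have hsum := sum_map_face ρ hone ((Equiv.mulLeft b⁻¹).trans (Equiv.mulRight b))
  simp only [Equiv.trans_apply, Equiv.coe_mulLeft, Equiv.coe_mulRight] at hsum
  rw [hsum, mul_one]

lemma hitLeft_Ftilde (ρ : DoubleDG G →ₗ[ℂ] Module.End ℂ H) (F : G → G → Module.End ℂ H)
    (d φ : DoubleDG G) :
    hitLeft ρ d (Ftilde F φ) = ∑ h : G, ∑ g : G, φ (h, g) • hitLeft ρ d (F h⁻¹ g) := by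
  let L : Module.End ℂ H →ₗ[ℂ] Module.End ℂ H := ∑ t : G, ∑ u : G, ∑ h : G,
    d (t * u, h) • (LinearMap.mulRight ℂ (ρ (DGbasis (h⁻¹ * u⁻¹ * h) h⁻¹)) ∘ₗ
      LinearMap.mulLeft ℂ (ρ (DGbasis t h)))
  have hL (A : Module.End ℂ H) : hitLeft ρ d A = L A := by
    simp [L, hitLeft, LinearMap.sum_apply]
  simp only [hL, Ftilde, map_sum, map_smul]

lemma hitRight_Ftilde (ρ : DoubleDG G →ₗ[ℂ] Module.End ℂ H) (F : G → G → Module.End ℂ H)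
    (d φ : DoubleDG G) :
    hitRight ρ d (Ftilde F φ) = ∑ h : G, ∑ g : G, φ (h, g) • hitRight ρ d (F h⁻¹ g) := by
  let L : Module.End ℂ H →ₗ[ℂ] Module.End ℂ H := ∑ t : G, ∑ u : G, ∑ h : G,
    d (t * u, h) • (LinearMap.mulRight ℂ (ρ (DGbasis u h)) ∘ₗ
      LinearMap.mulLeft ℂ (ρ (DGbasis (h⁻¹ * t⁻¹ * h) h⁻¹)))
  have hL (A : Module.End ℂ H) : hitRight ρ d A = L A := by
    simp [L, hitRight, LinearMap.sum_apply]
  simp only [hL, Ftilde, map_sum, map_smul]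

theorem statement14
    (ρ₀ ρ₁ : DoubleDG G →ₗ[ℂ] Module.End ℂ H)
    (hρ₀mul : ∀ x y : DoubleDG G, ρ₀ (DGmul x y) = ρ₀ x * ρ₀ y)
    (hρ₀one : ρ₀ DGone = 1)
    (hρ₁mul : ∀ x y : DoubleDG G, ρ₁ (DGmul x y) = ρ₁ x * ρ₁ y)
    (hρ₁one : ρ₁ DGone = 1)
    (F : G → G → Module.End ℂ H)
    (hcomm₀vert : ∀ f h g : G,
      ρ₀ (∑ t : G, DGbasis t f) * F h g =
        F (f * h * f⁻¹) (f * g) * ρ₀ (∑ t : G, DGbasis t f))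
    (hcomm₀face : ∀ f h g : G,
      ρ₀ (DGbasis f 1) * F h g = F h g * ρ₀ (DGbasis (h⁻¹ * f) 1))
    (hcomm₁vert : ∀ f h g : G,
      ρ₁ (∑ t : G, DGbasis t f) * F h g =
        F h (g * f⁻¹) * ρ₁ (∑ t : G, DGbasis t f))
    (hcomm₁face : ∀ f h g : G,
      ρ₁ (DGbasis f 1) * F h g = F h g * ρ₁ (DGbasis (f * (g⁻¹ * h * g)) 1)) :
    (∀ (d φ : DoubleDG G),
      Ftilde F (coregLeft d φ) = hitLeft ρ₀ d (Ftilde F φ)) ∧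
    (∀ (d φ : DoubleDG G),
      Ftilde F (coregRight φ d) = hitRight ρ₁ d (Ftilde F φ)) := by
  constructor
  · intro d φ
    rw [hitLeft_Ftilde]
    simp only [hitLeft_ribbon ρ₀ hρ₀mul hρ₀one F hcomm₀vert hcomm₀face, Ftilde, coregLeft_apply,
      Finset.sum_smul, Finset.smul_sum]
    rw [Finset.sum_comm_cycle]
    conv_rhs => rw [Finset.sum_comm_cycle]
    refine Finset.sum_congr rfl fun b _ => ?_
    rw [← Equiv.sum_comp ((Equiv.mulLeft b).trans (Equiv.mulRight b⁻¹))]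
    refine Finset.sum_congr rfl fun h _ => ?_
    rw [← Equiv.sum_comp (Equiv.mulLeft b)]
    refine Finset.sum_congr rfl fun g _ => ?_
    simp [mul_assoc, mul_smul]
  · intro d φ
    rw [hitRight_Ftilde]
    simp only [hitRight_ribbon ρ₁ hρ₁mul hρ₁one F hcomm₁vert hcomm₁face, Ftilde,
      coregRight_apply, Finset.sum_smul, Finset.smul_sum]
    refine Finset.sum_congr rfl fun h _ => ?_
    rw [Finset.sum_comm]
    conv_rhs => rw [Finset.sum_comm]
    refine Finset.sum_congr rfl fun b _ => ?_
    rw [← Equiv.sum_comp (Equiv.mulRight b)]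
    refine Finset.sum_congr rfl fun g _ => ?_
    simp [mul_assoc, mul_smul]

end
end

section
/- W^{e,π} ∘ W^{e,π'} = W^{e, π⊗π'} for all finite-dimensional complex representations π, π' of G, where π ⊗ π' is the tensor product representation. -/
/-!
Ribbon trace operators compose according to the tensor product of representations:
`W^{e,π} ∘ W^{e,π'} = W^{e,π⊗π'}`.
-/

noncomputable section

open scoped BigOperators TensorProduct

/-- `W^{e,π} ∘ W^{e,π'} = W^{e, π ⊗ π'}`, where
`W^{e,π} = Σ_{n∈G} Tr_π(n⁻¹) F^{e,n}` and the chargeon ribbon operators satisfy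
`F^{e,g} ∘ F^{e,g'} = [g = g'] F^{e,g}`. -/
theorem statement16 {G : Type*} [Group G] [Fintype G] [DecidableEq G]
    {H : Type*} [AddCommGroup H] [Module ℂ H]
    (F : G → Module.End ℂ H)
    (hF : ∀ g g' : G, F g * F g' = if g = g' then F g else 0)
    {V V' : Type*} [AddCommGroup V] [Module ℂ V] [FiniteDimensional ℂ V]
    [AddCommGroup V'] [Module ℂ V'] [FiniteDimensional ℂ V']
    (π : Representation ℂ G V) (π' : Representation ℂ G V') :
    (∑ n : G, (LinearMap.trace ℂ V (π n⁻¹)) • F n) *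
      (∑ n : G, (LinearMap.trace ℂ V' (π' n⁻¹)) • F n) =
    ∑ n : G, (LinearMap.trace ℂ (V ⊗[ℂ] V') ((π.tprod π') n⁻¹)) • F n := by
  simp only [Finset.sum_mul_sum, smul_mul_smul_comm, hF, smul_ite, smul_zero, Finset.sum_ite_eq,
    Finset.mem_univ, if_true, Representation.tprod_apply, LinearMap.trace_tensorProduct']

end
end
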